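/- The six linear Nakayama algebras A_{7,(1)}^{(4)}, A_{7,(1)}^{(5)}, A_{7,(2)}^{(3)}, A_{7,(2)}^{(5)}, A_{7,(3)}^{(3)} and A_{7,(3)}^{(4)} are pairwise derived equivalent, and each of them is derived equivalent to the path algebra of any orientation of the Dynkin tree E_7. -/

import Mathlib

open CategoryTheory

/-- A finite quiver: a finite vertex type, an arrow type, and source/target maps. -/
structure PreQuiver where
  V : Type
  A : Type
  [fintV : Fintype V]
  s : A → V
  t : A → V

attribute [instance] PreQuiver.fintV

/-- The defining relations presenting the path algebra of the quiver `Q` over `k`, together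
with the zero relations given by the paths (lists of composable arrows) in `R`.  The
generators are the trivial paths `Sum.inl v` (one for each vertex) and the arrows
`Sum.inr a`; multiplication of generators corresponds to concatenation of paths, so that the
resulting algebra has as a basis the paths of `Q` (not passing through a relation of `R`). -/
inductive PathAlgRel (k : Type) [Field k] (Q : PreQuiver) (R : Set (List Q.A)) :
    FreeAlgebra k (Q.V ⊕ Q.A) → FreeAlgebra k (Q.V ⊕ Q.A) → Prop
  | idem (v : Q.V) :
      PathAlgRel k Q R (FreeAlgebra.ι k (Sum.inl v) * FreeAlgebra.ι k (Sum.inl v))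
        (FreeAlgebra.ι k (Sum.inl v))
  | orth (v w : Q.V) (h : v ≠ w) :
      PathAlgRel k Q R (FreeAlgebra.ι k (Sum.inl v) * FreeAlgebra.ι k (Sum.inl w)) 0
  | unit :
      PathAlgRel k Q R (∑ v : Q.V, FreeAlgebra.ι k (Sum.inl v)) 1
  | source (a : Q.A) :
      PathAlgRel k Q R (FreeAlgebra.ι k (Sum.inl (Q.s a)) * FreeAlgebra.ι k (Sum.inr a))
        (FreeAlgebra.ι k (Sum.inr a))
  | target (a : Q.A) :
      PathAlgRel k Q R (FreeAlgebra.ι k (Sum.inr a) * FreeAlgebra.ι k (Sum.inl (Q.t a)))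
        (FreeAlgebra.ι k (Sum.inr a))
  | zeroRel (p : List Q.A) (hp : p ∈ R) :
      PathAlgRel k Q R ((p.map fun a => FreeAlgebra.ι k (Sum.inr a)).prod) 0

/-- The path algebra of the quiver `Q` over the field `k`, modulo the two-sided ideal
generated by the zero relations in `R`. -/
abbrev PathAlgebraRel (k : Type) [Field k] (Q : PreQuiver) (R : Set (List Q.A)) : Type :=
  RingQuot (PathAlgRel k Q R)

/-- The path algebra of the quiver `Q` over the field `k`. -/
abbrev PathAlgebra (k : Type) [Field k] (Q : PreQuiver) : Type :=
  PathAlgebraRel k Q ∅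

noncomputable instance (C : Type*) [Category C] [Abelian C] : HasDerivedCategory C :=
  HasDerivedCategory.standard C

/-- Two `k`-algebras are *derived equivalent* if there is a triangulated equivalence between
the derived categories of their categories of right modules (i.e. of left modules over the
opposite rings). -/
def DerivedEquivalent (k : Type) [Field k] (A : Type) [Ring A] [Algebra k A]
    (B : Type) [Ring B] [Algebra k B] : Prop :=
  ∃ (F : DerivedCategory (ModuleCat.{0} Aᵐᵒᵖ) ⥤ DerivedCategory (ModuleCat.{0} Bᵐᵒᵖ))
    (c : F.CommShift ℤ), haveI := c; (F.IsTriangulated ∧ F.IsEquivalence)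

/-- The linearly ordered quiver `A_n` of Dynkin type `A`, with vertices `1, …, n`
(realized as `Fin n`) and an arrow from each vertex to the next one. -/
def linQuiver (n : ℕ) : PreQuiver where
  V := Fin n
  A := Fin (n - 1)
  s := fun a => ⟨a.1, by have := a.2; omega⟩
  t := fun a => ⟨a.1 + 1, by have := a.2; omega⟩

/-- The path of length `l` in the quiver `A_n` starting at the (1-indexed) vertex `v`. -/
def linPath (n : ℕ) (v l : ℕ) : List (linQuiver n).A :=
  (List.range l).filterMap fun j =>
    if h : v - 1 + j < n - 1 then some ⟨v - 1 + j, h⟩ else none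

/-- The linear Nakayama algebra `A_{n,(n_0,…,n_{t-1})}^{(l_0,…,l_{t-1})}`: the quotient of
the path algebra of `A_n` over `k` by the two-sided ideal generated, for each `i`, by the
path of length `ls i` starting at the vertex `ns i`. -/
abbrev NakayamaAlgebra (k : Type) [Field k] (n t : ℕ) (ns ls : Fin t → ℕ) : Type :=
  PathAlgebraRel k (linQuiver n) {p | ∃ i : Fin t, p = linPath n (ns i) (ls i)}

/-- The hypotheses on the data of a linear Nakayama algebra
`A_{n,(n_0,…,n_{t-1})}^{(l_0,…,l_{t-1})}` with almost separate relations: each relation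
starts at a vertex `ns i ≥ 1` and has length `ls i ≥ 2`, the start vertices are strictly
increasing, the end vertices `ns i + ls i` are strictly increasing and at most `n`, and the
overlap of two relations is at most one arrow (`ns j ≥ ns i + ls i - 1` for `i < j`). -/
structure IsASNakayama (n t : ℕ) (ns ls : Fin t → ℕ) : Prop where
  one_le : ∀ i, 1 ≤ ns i
  two_le : ∀ i, 2 ≤ ls i
  start_lt : ∀ i j, i < j → ns i < ns j
  end_lt : ∀ i j, i < j → ns i + ls i < ns j + ls j
  end_le : ∀ i, ns i + ls i ≤ n
  almost_separate : ∀ i j, i < j → ns i + ls i ≤ ns j + 1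

/-- An orientation of a graph, given by a relation selecting a direction for each edge,
regarded as a quiver. -/
def orientQuiver (V : Type) [Fintype V] (o : V → V → Prop) : PreQuiver where
  V := V
  A := { p : V × V // o p.1 p.2 }
  s := fun a => a.1.1
  t := fun a => a.1.2

/-- `o` is an orientation of the simple graph `G` if each edge of `G` is directed in exactly
one way by `o`, and `o` directs nothing else. -/
def IsOrientation {V : Type} (G : SimpleGraph V) (o : V → V → Prop) : Prop :=
  (∀ v w, G.Adj v w ↔ o v w ∨ o w v) ∧ ∀ v w, o v w → ¬o w v

/-- The Dynkin tree `E_7`: a path on the six vertices `0, 1, …, 5` together with the extra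
vertex `6` attached to the vertex `2` (the third vertex from the end `0`). -/
def dynkinE7 : SimpleGraph (Fin 7) :=
  SimpleGraph.fromRel fun x y => (y.1 = x.1 + 1 ∧ y.1 ≤ 5) ∨ (x.1 = 2 ∧ y.1 = 6)

/-- The data `(n_0, l_0)` of the six Nakayama algebras `A_{7,(1)}^{(4)}`, `A_{7,(1)}^{(5)}`,
`A_{7,(2)}^{(3)}`, `A_{7,(2)}^{(5)}`, `A_{7,(3)}^{(3)}`, `A_{7,(3)}^{(4)}`. -/
def e7Data : List (ℕ × ℕ) := [(1, 4), (1, 5), (2, 3), (2, 5), (3, 3), (3, 4)]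

set_option linter.all false

-- Part 1

namespace NakE7
open Limits

section CommaAbelian

universe v₁ v₂ v₃ u₁ u₂ u₃
variable {A : Type u₁} [Category.{v₁} A] {B : Type u₂} [Category.{v₂} B]
  {T : Type u₃} [Category.{v₃} T] (L : A ⥤ T) (R : B ⥤ T)

instance commaFst_preservesFiniteLimits [HasFiniteLimits A] [HasFiniteLimits B]
    [PreservesFiniteLimits R] : PreservesFiniteLimits (Comma.fst L R) where
  preservesFiniteLimits J _ _ :=
    { preservesLimit := fun {K} => preservesLimit_of_preserves_limit_cone
        (Comma.coneOfPreservesIsLimit K (limit.isLimit _) (limit.isLimit _))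
        (limit.isLimit _) }

instance commaSnd_preservesFiniteLimits [HasFiniteLimits A] [HasFiniteLimits B]
    [PreservesFiniteLimits R] : PreservesFiniteLimits (Comma.snd L R) where
  preservesFiniteLimits J _ _ :=
    { preservesLimit := fun {K} => preservesLimit_of_preserves_limit_cone
        (Comma.coneOfPreservesIsLimit K (limit.isLimit _) (limit.isLimit _))
        (limit.isLimit _) }

instance commaFst_preservesFiniteColimits [HasFiniteColimits A] [HasFiniteColimits B]
    [PreservesFiniteColimits L] : PreservesFiniteColimits (Comma.fst L R) where
  preservesFiniteColimits J _ _ := inferInstance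

instance commaSnd_preservesFiniteColimits [HasFiniteColimits A] [HasFiniteColimits B]
    [PreservesFiniteColimits L] : PreservesFiniteColimits (Comma.snd L R) where
  preservesFiniteColimits J _ _ := inferInstance

lemma comma_isIso {X Y : Comma L R} (f : X ⟶ Y) [IsIso f.left] [IsIso f.right] : IsIso f := by
  have : f = (Comma.isoMk (asIso f.left) (asIso f.right) f.w).hom := by ext <;> rfl
  rw [this]; infer_instance

noncomputable instance commaAbelian [Abelian A] [Abelian B] [Preadditive T] [L.Additive] [R.Additive]
    [PreservesFiniteColimits L] [PreservesFiniteLimits R] : Abelian (Comma L R) := by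
  haveI : HasFiniteProducts (Comma L R) := inferInstance
  haveI : ∀ {X Y : Comma L R} (f : X ⟶ Y), IsIso (Abelian.coimageImageComparison f) := by
    intro X Y f
    have h1 : IsIso ((Comma.fst L R).map (Abelian.coimageImageComparison f)) := by
      have e := Abelian.PreservesCoimageImageComparison.iso (Comma.fst L R) f
      exact (MorphismProperty.isomorphisms _ |>.arrow_mk_iso_iff e).2
        (inferInstanceAs (IsIso (Abelian.coimageImageComparison _)))
    have h2 : IsIso ((Comma.snd L R).map (Abelian.coimageImageComparison f)) := by
      have e := Abelian.PreservesCoimageImageComparison.iso (Comma.snd L R) f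
      exact (MorphismProperty.isomorphisms _ |>.arrow_mk_iso_iff e).2
        (inferInstanceAs (IsIso (Abelian.coimageImageComparison _)))
    haveI : IsIso (Abelian.coimageImageComparison f).left := h1
    haveI : IsIso (Abelian.coimageImageComparison f).right := h2
    exact comma_isIso L R _
  exact Abelian.ofCoimageImageComparisonIsIso

end CommaAbelian
end NakE7

-- Part 2

namespace NakE7
open Limits

universe v₁ v₂ v₃ v₄ u₁ u₂ u₃ u₄

section Ex
variable {A : Type u₁} [Category.{v₁} A] [Abelian A] {B : Type u₂} [Category.{v₂} B] [Abelian B]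
  {C : Type u₃} [Category.{v₃} C] [Abelian C] {E : Type u₄} [Category.{v₄} E] [Abelian E]

/-- exact additive functors -/
class Ex (F : A ⥤ B) : Prop where
  add : F.Additive
  lim : PreservesFiniteLimits F
  colim : PreservesFiniteColimits F

attribute [instance] Ex.add Ex.lim Ex.colim

instance Ex.id : Ex (𝟭 A) := ⟨inferInstance, inferInstance, inferInstance⟩
instance Ex.comp (F : A ⥤ B) (G : B ⥤ C) [Ex F] [Ex G] : Ex (F ⋙ G) :=
  ⟨inferInstance, comp_preservesFiniteLimits _ _, comp_preservesFiniteColimits _ _⟩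

lemma Ex.of_iso {F G : A ⥤ B} (e : F ≅ G) [Ex F] : Ex G :=
  ⟨Functor.additive_of_iso e, preservesFiniteLimits_of_natIso e, preservesFiniteColimits_of_natIso e⟩

/-- The derived functor of an exact functor. -/
noncomputable abbrev DF (F : A ⥤ B) [Ex F] : DerivedCategory A ⥤ DerivedCategory B :=
  F.mapDerivedCategory

noncomputable def chF (F : A ⥤ B) [Ex F] : CochainComplex A ℤ ⥤ CochainComplex B ℤ :=
  F.mapHomologicalComplex _

noncomputable def dfIso (F : A ⥤ B) [Ex F] :
    DerivedCategory.Q ⋙ DF F ≅ chF F ⋙ DerivedCategory.Q := F.mapDerivedCategoryFactors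

noncomputable instance dfSq (F : A ⥤ B) [Ex F] :
    CatCommSq (chF F) DerivedCategory.Q DerivedCategory.Q (DF F) := ⟨(dfIso F).symm⟩

/-- lift an iso after precomposing with Q -/
noncomputable def liftQIso {A : Type u₁} [Category.{v₁} A] [Abelian A] {E : Type u₄} [Category.{v₄} E]
    {F G : DerivedCategory A ⥤ E}
    (e : DerivedCategory.Q ⋙ F ≅ DerivedCategory.Q ⋙ G) : F ≅ G :=
  letI : Localization.Lifting DerivedCategory.Q (HomologicalComplex.quasiIso A (ComplexShape.up ℤ))
    (DerivedCategory.Q ⋙ F) F := ⟨Iso.refl _⟩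
  letI : Localization.Lifting DerivedCategory.Q (HomologicalComplex.quasiIso A (ComplexShape.up ℤ))
    (DerivedCategory.Q ⋙ G) G := ⟨Iso.refl _⟩
  Localization.liftNatIso DerivedCategory.Q (HomologicalComplex.quasiIso A (ComplexShape.up ℤ))
    (DerivedCategory.Q ⋙ F) (DerivedCategory.Q ⋙ G) F G e

noncomputable def dfMapIso {F G : A ⥤ B} [Ex F] [Ex G] (e : F ≅ G) : DF F ≅ DF G :=
  liftQIso (dfIso F ≪≫ Functor.isoWhiskerRight (NatIso.mapHomologicalComplex e _) _ ≪≫ (dfIso G).symm)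

noncomputable def dfComp (F : A ⥤ B) (G : B ⥤ C) [Ex F] [Ex G] : DF F ⋙ DF G ≅ DF (F ⋙ G) :=
  liftQIso ((Functor.associator _ _ _).symm ≪≫ Functor.isoWhiskerRight (dfIso F) _ ≪≫
    Functor.associator _ _ _ ≪≫ Functor.isoWhiskerLeft _ (dfIso G) ≪≫
    (Functor.associator _ _ _).symm ≪≫ (dfIso (F ⋙ G)).symm)

noncomputable def dfId : DF (𝟭 A) ≅ 𝟭 _ :=
  liftQIso (dfIso (𝟭 A) ≪≫
    Functor.isoWhiskerRight (Functor.mapHomologicalComplexIdIso A _) _ ≪≫ Functor.leftUnitor _ ≪≫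
    (Functor.rightUnitor _).symm)

noncomputable def dfCompIso {F : A ⥤ B} {G : B ⥤ C} {H : A ⥤ C} [Ex F] [Ex G] [Ex H]
    (e : F ⋙ G ≅ H) : DF F ⋙ DF G ≅ DF H := dfComp F G ≪≫ dfMapIso e

noncomputable def chAdj {F : A ⥤ B} {G : B ⥤ A} [Ex F] [Ex G] (adj : F ⊣ G) : chF F ⊣ chF G :=
  Adjunction.mkOfUnitCounit
    { unit :=
        { app := fun K => { f := fun n => adj.unit.app (K.X n)
                            comm' := fun i j _ => (adj.unit.naturality (K.d i j)).symm }
          naturality := fun K L f => by ext n; exact adj.unit.naturality (f.f n) }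
      counit :=
        { app := fun K => { f := fun n => adj.counit.app (K.X n)
                            comm' := fun i j _ => (adj.counit.naturality (K.d i j)).symm }
          naturality := fun K L f => by ext n; exact adj.counit.naturality (f.f n) }
      left_triangle := by
        ext K n
        have := adj.left_triangle_components (K.X n)
        simp [chF]
        exact this
      right_triangle := by
        ext K n
        have := adj.right_triangle_components (K.X n)
        simp [chF]
        exact this }

lemma chAdj_counit_f {F : A ⥤ B} {G : B ⥤ A} [Ex F] [Ex G] (adj : F ⊣ G) (K) (n : ℤ) :
    ((chAdj adj).counit.app K).f n = adj.counit.app (K.X n) := rfl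

noncomputable def dfAdj {F : A ⥤ B} {G : B ⥤ A} [Ex F] [Ex G] (adj : F ⊣ G) : DF F ⊣ DF G :=
  (chAdj adj).localization DerivedCategory.Q
    (HomologicalComplex.quasiIso A (ComplexShape.up ℤ)) DerivedCategory.Q
    (HomologicalComplex.quasiIso B (ComplexShape.up ℤ)) _ _

lemma dfAdj_counit_Q {F : A ⥤ B} {G : B ⥤ A} [Ex F] [Ex G] (adj : F ⊣ G) (K : CochainComplex B ℤ) :
    ∃ e : (DF F).obj ((DF G).obj (DerivedCategory.Q.obj K)) ≅
      DerivedCategory.Q.obj ((chF F).obj ((chF G).obj K)),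
    (dfAdj adj).counit.app (DerivedCategory.Q.obj K) =
      e.hom ≫ DerivedCategory.Q.map ((chAdj adj).counit.app K) := by
  refine ⟨(DF F).mapIso ((dfIso G).app K) ≪≫ (dfIso F).app _, ?_⟩
  erw [Adjunction.localization_counit_app]
  rw [← Category.assoc]; rfl

/-- if `N` sends the counit at `P X` to an iso, then so at the derived level. -/
lemma df_counit_iso {F : A ⥤ B} {G : B ⥤ A} [Ex F] [Ex G] (adj : F ⊣ G) (P : C ⥤ B) [Ex P]
    (N : B ⥤ E) [Ex N] (h : ∀ X, IsIso (N.map (adj.counit.app (P.obj X)))) (X : DerivedCategory C) :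
    IsIso ((DF N).map ((dfAdj adj).counit.app ((DF P).obj X))) := by
  obtain ⟨K, ⟨e⟩⟩ : ∃ K : CochainComplex C ℤ, Nonempty (DerivedCategory.Q.obj K ≅ X) :=
    ⟨DerivedCategory.Q.objPreimage X, ⟨DerivedCategory.Q.objObjPreimageIso X⟩⟩
  let i : DerivedCategory.Q.obj ((chF P).obj K) ≅ (DF P).obj X :=
    ((dfIso P).app K).symm ≪≫ (DF P).mapIso e
  have key : IsIso ((DF N).map ((dfAdj adj).counit.app
      (DerivedCategory.Q.obj ((chF P).obj K)))) := by
    obtain ⟨j, hj⟩ := dfAdj_counit_Q adj ((chF P).obj K)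
    rw [hj, Functor.map_comp]
    have : IsIso ((chF N).map ((chAdj adj).counit.app ((chF P).obj K))) := by
      have : ∀ n, IsIso (((chF N).map ((chAdj adj).counit.app ((chF P).obj K))).f n) := by
        intro n
        have h2 := h (K.X n)
        have e1 : ((chF N).map ((chAdj adj).counit.app ((chF P).obj K))).f n =
          N.map (((chAdj adj).counit.app ((chF P).obj K)).f n) := rfl
        rw [e1, chAdj_counit_f]
        exact h2
      exact HomologicalComplex.Hom.isIso_of_components _
    have : IsIso ((DerivedCategory.Q ⋙ DF N).map ((chAdj adj).counit.app ((chF P).obj K))) := by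
      rw [NatIso.isIso_map_iff (dfIso N)]
      dsimp; infer_instance
    have : IsIso ((DF N).map (DerivedCategory.Q.map ((chAdj adj).counit.app ((chF P).obj K)))) := this
    infer_instance
  have nat := (dfAdj adj).counit.naturality i.hom
  have h3 : (dfAdj adj).counit.app ((DF P).obj X) =
      (DF F).map ((DF G).map i.inv) ≫ (dfAdj adj).counit.app _ ≫ i.hom := by
    rw [← Functor.id_map i.hom, ← nat, ← Category.assoc]
    have : (DF F).map ((DF G).map i.inv) ≫ (DF G ⋙ DF F).map i.hom = 𝟙 _ := by
      rw [← Functor.comp_map, ← Functor.map_comp]; simp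
    erw [this]; simp
  rw [h3, Functor.map_comp, Functor.map_comp]
  infer_instance

/-- homology commutes with exact functors -/
lemma df_homology (F : A ⥤ B) [Ex F] (X : DerivedCategory A) (n : ℤ) :
    Nonempty ((DerivedCategory.homologyFunctor B n).obj ((DF F).obj X) ≅
      F.obj ((DerivedCategory.homologyFunctor A n).obj X)) := by
  let K := DerivedCategory.Q.objPreimage X
  let e := DerivedCategory.Q.objObjPreimageIso X
  exact ⟨(DerivedCategory.homologyFunctor B n).mapIso ((DF F).mapIso e.symm ≪≫ (dfIso F).app K) ≪≫
    (DerivedCategory.homologyFunctorFactors B n).app _ ≪≫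
    (ShortComplex.mapHomologyIso (K.sc n) F) ≪≫
    F.mapIso ((DerivedCategory.homologyFunctorFactors A n).symm.app K ≪≫
      (DerivedCategory.homologyFunctor A n).mapIso e)⟩

lemma isZero_iff_homology (X : DerivedCategory A) :
    IsZero X ↔ ∀ n, IsZero ((DerivedCategory.homologyFunctor A n).obj X) := by
  constructor
  · intro h n
    exact Functor.map_isZero _ h
  · intro h
    obtain ⟨Z, hZ⟩ := HasZeroObject.zero (C := DerivedCategory A)
    have : IsIso (0 : X ⟶ Z) := by
      rw [DerivedCategory.isIso_iff]
      intro n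
      exact ⟨⟨0, (h n).eq_of_src _ _,
        (Functor.map_isZero (DerivedCategory.homologyFunctor A n) hZ).eq_of_src _ _⟩⟩
    exact hZ.of_iso (asIso (0 : X ⟶ Z))

lemma df_isZero_of_zero (F : A ⥤ B) [Ex F] (h : ∀ X, IsZero (F.obj X)) (X : DerivedCategory A) :
    IsZero ((DF F).obj X) := by
  rw [isZero_iff_homology]
  intro n
  exact (h _).of_iso (df_homology F X n).some

lemma df_joint_zero (F : A ⥤ B) [Ex F] (G : A ⥤ C) [Ex G]
    (h : ∀ X, IsZero (F.obj X) → IsZero (G.obj X) → IsZero X) (X : DerivedCategory A)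
    (h1 : IsZero ((DF F).obj X)) (h2 : IsZero ((DF G).obj X)) : IsZero X := by
  rw [isZero_iff_homology] at *
  intro n
  exact h _ ((h1 n).of_iso (df_homology F X n).some.symm)
    ((h2 n).of_iso (df_homology G X n).some.symm)

lemma isZero_of_comp_zero (F : A ⥤ B) (G : B ⥤ C) [Ex F] [Ex G] (h : ∀ X, IsZero (G.obj (F.obj X)))
    (X : DerivedCategory A) : IsZero ((DF G).obj ((DF F).obj X)) :=
  (df_isZero_of_zero (F ⋙ G) h X).of_iso ((dfComp F G).app X)

end Ex
end NakE7

-- Part 3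

namespace NakE7
open Limits Pretriangulated

universe v₁ v₂ v₃ v₄ u₁ u₂ u₃ u₄

section Tri
variable {S : Type u₁} [Category.{v₁} S] [Preadditive S] [HasZeroObject S] [HasShift S ℤ]
  [∀ n : ℤ, (shiftFunctor S n).Additive] [Pretriangulated S]
  {T : Type u₂} [Category.{v₂} T] [Preadditive T] [HasZeroObject T] [HasShift T ℤ]
  [∀ n : ℤ, (shiftFunctor T n).Additive] [Pretriangulated T]

/-- `F` is bijective on `Hom(X,Y)` -/
def Bij (F : S ⥤ T) (X Y : S) : Prop := Function.Bijective (fun f : X ⟶ Y => F.map f)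

lemma Bij.iso_left {F : S ⥤ T} {X X' Y : S} (h : Bij F X Y) (e : X ≅ X') : Bij F X' Y := by
  constructor
  · intro f g hfg
    have hfg : F.map f = F.map g := hfg
    have h2 : F.map (e.hom ≫ f) = F.map (e.hom ≫ g) := by
      rw [Functor.map_comp, Functor.map_comp, hfg]
    exact (cancel_epi e.hom).1 (h.1 h2)
  · intro f
    obtain ⟨g, hg⟩ := h.2 (F.map e.hom ≫ f)
    have hg : F.map g = F.map e.hom ≫ f := hg
    refine ⟨e.inv ≫ g, ?_⟩
    show F.map (e.inv ≫ g) = f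
    rw [Functor.map_comp, hg, ← Functor.map_comp_assoc]; simp

lemma Bij.iso_right {F : S ⥤ T} {X Y Y' : S} (h : Bij F X Y) (e : Y ≅ Y') : Bij F X Y' := by
  constructor
  · intro f g hfg
    have hfg : F.map f = F.map g := hfg
    have h2 : F.map (f ≫ e.inv) = F.map (g ≫ e.inv) := by
      rw [Functor.map_comp, Functor.map_comp, hfg]
    exact (cancel_mono e.inv).1 (h.1 h2)
  · intro f
    obtain ⟨g, hg⟩ := h.2 (f ≫ F.map e.inv)
    have hg : F.map g = f ≫ F.map e.inv := hg
    refine ⟨g ≫ e.hom, ?_⟩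
    show F.map (g ≫ e.hom) = f
    rw [Functor.map_comp, hg, Category.assoc, ← Functor.map_comp]; simp

lemma Bij.of_zero {F : S ⥤ T} {X Y : S} (h : ∀ f : X ⟶ Y, f = 0)
    (h' : ∀ f : F.obj X ⟶ F.obj Y, f = 0) : Bij F X Y :=
  ⟨fun f g _ => (h f).trans (h g).symm, fun f => ⟨0, (h' _).trans (h' _).symm⟩⟩

lemma Bij.natIso {F G : S ⥤ T} (e : F ≅ G) {X Y : S} (h : Bij F X Y) : Bij G X Y := by
  constructor
  · intro f g hfg
    have hfg : G.map f = G.map g := hfg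
    apply h.1
    show F.map f = F.map g
    rw [← cancel_mono (e.hom.app Y), e.hom.naturality, e.hom.naturality, hfg]
  · intro f
    obtain ⟨g, hg⟩ := h.2 (e.hom.app X ≫ f ≫ e.inv.app Y)
    have hg : F.map g = e.hom.app X ≫ f ≫ e.inv.app Y := hg
    refine ⟨g, ?_⟩
    show G.map g = f
    rw [← cancel_epi (e.hom.app X), ← e.hom.naturality, hg]
    simp

variable (F : S ⥤ T) [F.CommShift ℤ] [F.IsTriangulated]

lemma tri_inv (t : Triangle S) (ht : t ∈ distTriang S) :
    ∃ m : t.obj₃⟦(-1:ℤ)⟧ ⟶ t.obj₁, m ≫ t.mor₁ = 0 ∧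
    (∀ (Y : S) (g : t.obj₁ ⟶ Y), m ≫ g = 0 → ∃ g2 : t.obj₂ ⟶ Y, g = t.mor₁ ≫ g2) ∧
    (∀ (X : T) (g : X ⟶ F.obj t.obj₁), g ≫ F.map t.mor₁ = 0 →
      ∃ k : X ⟶ F.obj (t.obj₃⟦(-1:ℤ)⟧), g = k ≫ F.map m) := by
  have hFi := F.map_distinguished _ (inv_rot_of_distTriang _ ht)
  exact ⟨t.invRotate.mor₁, comp_distTriang_mor_zero₁₂ _ (inv_rot_of_distTriang _ ht),
    fun Y g h => Triangle.yoneda_exact₂ _ (inv_rot_of_distTriang _ ht) g h,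
    fun X g h => Triangle.coyoneda_exact₂ _ hFi g h⟩

lemma tri_rot (t : Triangle S) (ht : t ∈ distTriang S) :
    (∀ (Y : T) (g : F.obj t.obj₃ ⟶ Y), F.map t.mor₂ ≫ g = 0 →
      ∃ k : F.obj (t.obj₁⟦(1:ℤ)⟧) ⟶ Y, g = F.map t.mor₃ ≫ k) ∧
    (∀ (Y : T) (g : F.obj t.obj₂ ⟶ Y), F.map t.mor₁ ≫ g = 0 →
      ∃ k : F.obj t.obj₃ ⟶ Y, g = F.map t.mor₂ ≫ k) ∧
    (∀ (X : T) (g : X ⟶ F.obj t.obj₂), g ≫ F.map t.mor₂ = 0 →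
      ∃ k : X ⟶ F.obj t.obj₁, g = k ≫ F.map t.mor₁) := by
  have hF := F.map_distinguished t ht
  have hFr := F.map_distinguished _ (rot_of_distTriang _ ht)
  exact ⟨fun Y g h => Triangle.yoneda_exact₂ _ hFr g h, fun Y g h => Triangle.yoneda_exact₂ _ hF g h,
    fun Y g h => Triangle.coyoneda_exact₂ _ hF g h⟩

lemma Bij.ext_left (t : Triangle S) (ht : t ∈ distTriang S) (Y : S)
    (h1 : Bij F (t.obj₁⟦(1:ℤ)⟧) Y) (h2 : Bij F t.obj₃ Y) (h3 : Bij F t.obj₁ Y)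
    (h4 : Bij F (t.obj₃⟦(-1:ℤ)⟧) Y) : Bij F t.obj₂ Y := by
  obtain ⟨r1, r2, -⟩ := tri_rot F t ht
  obtain ⟨m, m1, m2, -⟩ := tri_inv F t ht
  have inj0 : ∀ f : t.obj₂ ⟶ Y, F.map f = 0 → f = 0 := by
    intro f hf
    have a0 : F.map (t.mor₁ ≫ f) = F.map 0 := by rw [Functor.map_comp, hf, comp_zero, F.map_zero]
    have a1 : t.mor₁ ≫ f = 0 := h3.1 a0
    obtain ⟨g, rfl⟩ := Triangle.yoneda_exact₂ t ht f a1
    obtain ⟨k, hk⟩ := r1 _ (F.map g) (by rw [← hf, Functor.map_comp])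
    obtain ⟨k, rfl⟩ := h1.2 k
    have hk : F.map g = F.map (t.mor₃ ≫ k) := by rw [hk, Functor.map_comp]
    have : g = t.mor₃ ≫ k := h2.1 hk
    rw [this, ← Category.assoc, comp_distTriang_mor_zero₂₃ _ ht, zero_comp]
  constructor
  · intro f g hfg
    have hfg : F.map f = F.map g := hfg
    have := inj0 (f - g) (by rw [Functor.map_sub, hfg, sub_self])
    exact sub_eq_zero.1 this
  · intro f
    obtain ⟨g, hg⟩ := h3.2 (F.map t.mor₁ ≫ f)
    have hg : F.map g = F.map t.mor₁ ≫ f := hg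
    have z0 : F.map (m ≫ g) = F.map 0 := by
      rw [Functor.map_comp, hg, ← Category.assoc, ← Functor.map_comp, m1]; simp
    have z : m ≫ g = 0 := h4.1 z0
    obtain ⟨g2, hg2⟩ := m2 _ g z
    obtain ⟨h, hh⟩ := r2 _ (f - F.map g2) (by
        rw [Preadditive.comp_sub, ← hg, hg2, Functor.map_comp, sub_self])
    obtain ⟨h, rfl⟩ := h2.2 h
    refine ⟨g2 + t.mor₂ ≫ h, ?_⟩
    have hh' : f - F.map g2 = F.map t.mor₂ ≫ F.map h := hh
    show F.map (g2 + t.mor₂ ≫ h) = f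
    rw [Functor.map_add, Functor.map_comp, ← hh']
    abel

lemma Bij.ext_right (t : Triangle S) (ht : t ∈ distTriang S) (X : S)
    (h1 : Bij F X (t.obj₃⟦(-1:ℤ)⟧)) (h2 : Bij F X t.obj₁) (h3 : Bij F X t.obj₃)
    (h4 : Bij F X (t.obj₁⟦(1:ℤ)⟧)) : Bij F X t.obj₂ := by
  obtain ⟨-, -, r3⟩ := tri_rot F t ht
  obtain ⟨m, m1, -, m3⟩ := tri_inv F t ht
  have inj0 : ∀ f : X ⟶ t.obj₂, F.map f = 0 → f = 0 := by
    intro f hf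
    have a0 : F.map (f ≫ t.mor₂) = F.map 0 := by rw [Functor.map_comp, hf, zero_comp, F.map_zero]
    have a1 : f ≫ t.mor₂ = 0 := h3.1 a0
    obtain ⟨g, rfl⟩ := Triangle.coyoneda_exact₂ t ht f a1
    obtain ⟨k, hk⟩ := m3 _ (F.map g) (by rw [← hf, Functor.map_comp])
    obtain ⟨k, rfl⟩ := h1.2 k
    have hk : F.map g = F.map (k ≫ m) := by rw [hk, Functor.map_comp]
    have : g = k ≫ m := h2.1 hk
    rw [this, Category.assoc, m1, comp_zero]
  constructor
  · intro f g hfg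
    have hfg : F.map f = F.map g := hfg
    have := inj0 (f - g) (by rw [Functor.map_sub, hfg, sub_self])
    exact sub_eq_zero.1 this
  · intro f
    obtain ⟨g, hg⟩ := h3.2 (f ≫ F.map t.mor₂)
    have hg : F.map g = f ≫ F.map t.mor₂ := hg
    have z0 : F.map (g ≫ t.mor₃) = F.map 0 := by
      rw [Functor.map_comp, hg, Category.assoc, ← Functor.map_comp,
        comp_distTriang_mor_zero₂₃ _ ht]; simp
    have z : g ≫ t.mor₃ = 0 := h4.1 z0
    obtain ⟨g2, hg2⟩ := Triangle.coyoneda_exact₃ _ ht g z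
    obtain ⟨h, hh⟩ := r3 _ (f - F.map g2) (by
        rw [Preadditive.sub_comp, ← hg, hg2, Functor.map_comp, sub_self])
    obtain ⟨h, rfl⟩ := h2.2 h
    refine ⟨g2 + h ≫ t.mor₁, ?_⟩
    have hh' : f - F.map g2 = F.map h ≫ F.map t.mor₁ := hh
    show F.map (g2 + h ≫ t.mor₁) = f
    rw [Functor.map_add, Functor.map_comp, ← hh']
    abel

lemma ff_of_bij (h : ∀ X Y, Bij F X Y) : F.Full ∧ F.Faithful :=
  ⟨⟨fun {X Y} => (h X Y).2⟩, ⟨fun {X Y} => @(h X Y).1⟩⟩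

section Refl
variable (j : S ⥤ T)

/-- `g : w ⟶ j v` is a reflection. -/
def IsRefl {w : T} {v : S} (g : w ⟶ j.obj v) : Prop :=
  ∀ v', Function.Bijective (fun s : v ⟶ v' => g ≫ j.map s)

lemma isRefl_of_tri [j.Full] [j.Faithful] [j.CommShift ℤ] [j.IsTriangulated] {p w : T} {v : S}
    (f : p ⟶ w) (g : w ⟶ j.obj v) (h : j.obj v ⟶ p⟦(1:ℤ)⟧)
    (ht : Triangle.mk f g h ∈ distTriang T) (hp : ∀ v' (x : p ⟶ j.obj v'), x = 0) :
    IsRefl j g := by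
  intro v'
  have hp1 : ∀ y : p⟦(1:ℤ)⟧ ⟶ j.obj v', y = 0 := by
    intro y
    apply (shiftFunctor T (-1 : ℤ)).map_injective
    rw [Functor.map_zero]
    let e1 : (p⟦(1:ℤ)⟧)⟦(-1:ℤ)⟧ ≅ p := (shiftFunctorCompIsoId T (1:ℤ) (-1) (by simp)).app p
    let e2 : (j.obj v')⟦(-1:ℤ)⟧ ≅ j.obj (v'⟦(-1:ℤ)⟧) := ((j.commShiftIso (-1:ℤ)).app v').symm
    have := hp _ (e1.inv ≫ (shiftFunctor T (-1 : ℤ)).map y ≫ e2.hom)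
    rw [← cancel_epi e1.inv, ← cancel_mono e2.hom, Category.assoc, this]
    simp
  constructor
  · intro s s' hs
    have : g ≫ j.map (s - s') = 0 := by
      simp only at hs
      rw [Functor.map_sub, Preadditive.comp_sub, hs, sub_self]
    obtain ⟨y, hy⟩ : ∃ y : p⟦(1:ℤ)⟧ ⟶ j.obj v', j.map (s - s') = h ≫ y :=
      Triangle.yoneda_exact₃ _ ht _ this
    rw [hp1 y, comp_zero] at hy
    exact sub_eq_zero.1 (j.map_injective (hy.trans (j.map_zero _ _).symm))
  · intro f0
    obtain ⟨x, hx⟩ : ∃ x : j.obj v ⟶ j.obj v', f0 = g ≫ x :=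
      Triangle.yoneda_exact₂ _ ht f0 (hp _ _)
    refine ⟨j.preimage x, ?_⟩
    show g ≫ j.map (j.preimage x) = f0
    rw [Functor.map_preimage, hx]

lemma isRightAdjoint_of_refl (h : ∀ w : T, ∃ (v : S) (g : w ⟶ j.obj v), IsRefl j g) :
    j.IsRightAdjoint := by
  apply Functor.isRightAdjoint_of_leftAdjointObjIsDefined_eq_top
  ext w
  simp only [Pi.top_apply, Prop.top_eq_true, iff_true]
  obtain ⟨v, g, hg⟩ := h w
  exact ⟨⟨v, ⟨{ homEquiv := fun {v'} => Equiv.ofBijective _ (hg v')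
                homEquiv_comp := fun a b => by
                  show g ≫ j.map _ = (g ≫ j.map _) ≫ j.map _
                  rw [j.map_comp, Category.assoc] }⟩⟩⟩

lemma refl_unit_iso {l : T ⥤ S} (adj : l ⊣ j) {w : T} {v : S} {g : w ⟶ j.obj v} (hg : IsRefl j g) :
    ∃ e : l.obj w ≅ v, adj.unit.app w ≫ j.map e.hom = g := by
  let t := (adj.homEquiv w v).symm g
  have ht : adj.unit.app w ≫ j.map t = g := by
    have h1 : (adj.homEquiv w v) t = g := Equiv.apply_symm_apply _ _
    rw [adj.homEquiv_unit] at h1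
    exact h1
  obtain ⟨s, hs⟩ := (hg (l.obj w)).2 (adj.unit.app w)
  simp only at hs
  refine ⟨⟨t, s, ?_, ?_⟩, ht⟩
  · apply (adj.homEquiv _ _).injective
    rw [adj.homEquiv_unit, adj.homEquiv_unit, Functor.map_comp, ← Category.assoc, ht, hs]
    simp
  · apply (hg v).1
    simp only [Functor.map_comp]
    rw [← Category.assoc, hs, ht]
    simp

/-- the left adjoint of `j` is bijective on `Hom(w,w')` if there are no maps to the fibre -/
lemma refl_bij {l : T ⥤ S} (adj : l ⊣ j) {w : T} {p w' : T} {v : S}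
    (f : p ⟶ w') (g : w' ⟶ j.obj v) (h : j.obj v ⟶ p⟦(1:ℤ)⟧)
    (ht : Triangle.mk f g h ∈ distTriang T) (hg : IsRefl j g)
    (h0 : ∀ x : w ⟶ p, x = 0) (h1 : ∀ x : w ⟶ p⟦(1:ℤ)⟧, x = 0) : Bij l w w' := by
  obtain ⟨e, he⟩ := refl_unit_iso j adj hg
  have key : Function.Bijective (fun x : w ⟶ w' => x ≫ adj.unit.app w') := by
    have hu : adj.unit.app w' = g ≫ j.map e.inv := by
      rw [← he, Category.assoc, ← Functor.map_comp]; simp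
    rw [hu]
    constructor
    · intro x y hxy
      simp only at hxy
      have : x ≫ g = y ≫ g := by
        rw [← cancel_mono (j.map e.inv), Category.assoc, Category.assoc, hxy]
      have this : (x - y) ≫ g = 0 := by rw [Preadditive.sub_comp, this, sub_self]
      obtain ⟨z, hz⟩ : ∃ z : w ⟶ p, x - y = z ≫ f := Triangle.coyoneda_exact₂ _ ht (x - y) this
      rw [h0 z, zero_comp] at hz
      exact sub_eq_zero.1 hz
    · intro y
      have y' : w ⟶ j.obj (l.obj w') := y
      obtain ⟨z, hz⟩ : ∃ z : w ⟶ w', (show w ⟶ j.obj (l.obj w') from y) ≫ j.map e.hom = z ≫ g :=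
        Triangle.coyoneda_exact₃ _ ht _ (h1 _)
      refine ⟨z, ?_⟩
      show z ≫ g ≫ j.map e.inv = (show w ⟶ j.obj (l.obj w') from y)
      rw [← Category.assoc, ← hz, Category.assoc, ← Functor.map_comp]; simp
  have : (fun x : w ⟶ w' => l.map x) = (adj.homEquiv _ _).symm ∘ (fun x => x ≫ adj.unit.app w') := by
    funext x
    simp only [Function.comp]
    rw [Equiv.eq_symm_apply, adj.homEquiv_unit]
    exact (adj.unit.naturality x).symm
  unfold Bij
  rw [this]
  exact (Equiv.bijective _).comp key

end Refl
end Tri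
end NakE7

-- Part 4

namespace NakE7
open Limits Pretriangulated

universe v₁ v₂ v₃ v₄ u₁ u₂ u₃ u₄

section
variable {A : Type u₁} [Category.{v₁} A] [Abelian A] {B : Type u₂} [Category.{v₂} B] [Abelian B]
  {C : Type u₃} [Category.{v₃} C] [Abelian C] {E : Type u₄} [Category.{v₄} E] [Abelian E]

lemma Ex.comma (L : A ⥤ C) (R : B ⥤ C) [Ex L] [Ex R] (P : E ⥤ Comma L R)
    (h1 : Ex (P ⋙ Comma.fst L R)) (h2 : Ex (P ⋙ Comma.snd L R)) : Ex P where
  add := ⟨fun {X Y f g} => by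
    apply CommaMorphism.ext
    · exact (P ⋙ Comma.fst L R).map_add
    · exact (P ⋙ Comma.snd L R).map_add⟩
  lim := ⟨fun J _ _ => ⟨fun {K} => ⟨fun {c} hc => ⟨Comma.fstSndJointlyReflectLimit
    (isLimitOfPreserves (P ⋙ Comma.fst L R) hc) (isLimitOfPreserves (P ⋙ Comma.snd L R) hc)⟩⟩⟩⟩
  colim := ⟨fun J _ _ => ⟨fun {K} => ⟨fun {c} hc => ⟨Comma.fstSndJointlyReflectColimit
    (isColimitOfPreserves (P ⋙ Comma.fst L R) hc) (isColimitOfPreserves (P ⋙ Comma.snd L R) hc)⟩⟩⟩⟩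

instance Ex.fst (L : A ⥤ C) (R : B ⥤ C) [Ex L] [Ex R] : Ex (Comma.fst L R) :=
  ⟨⟨fun {X Y f g} => rfl⟩, inferInstance, inferInstance⟩
instance Ex.snd (L : A ⥤ C) (R : B ⥤ C) [Ex L] [Ex R] : Ex (Comma.snd L R) :=
  ⟨⟨fun {X Y f g} => rfl⟩, inferInstance, inferInstance⟩

lemma Ex.of_zero (F : A ⥤ B) (h : ∀ X, IsZero (F.obj X)) : Ex F where
  add := ⟨fun {X Y f g} => (h _).eq_of_src _ _⟩
  lim := ⟨fun J _ _ => ⟨fun {K} => ⟨fun {c} hc => ⟨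
    { lift := fun s => 0
      fac := fun s j => (h _).eq_of_tgt _ _
      uniq := fun s m hm => (h _).eq_of_tgt _ _ }⟩⟩⟩⟩
  colim := ⟨fun J _ _ => ⟨fun {K} => ⟨fun {c} hc => ⟨
    { desc := fun s => 0
      fac := fun s j => (h _).eq_of_src _ _
      uniq := fun s m hm => (h _).eq_of_src _ _ }⟩⟩⟩⟩

lemma comma_zero (L : A ⥤ C) (R : B ⥤ C) [Ex L] [Ex R] (X : Comma L R) (h1 : IsZero X.left)
    (h2 : IsZero X.right) : IsZero X := by
  rw [IsZero.iff_id_eq_zero]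
  apply CommaMorphism.ext
  · exact h1.eq_of_src _ _
  · exact h2.eq_of_src _ _

/-- ff from retraction, left adjoint version -/
lemma df_ff_left {F : A ⥤ B} {G : B ⥤ A} [Ex F] [Ex G] (adj : F ⊣ G) (e : F ⋙ G ≅ 𝟭 A) :
    Nonempty (DF F).FullyFaithful :=
  ⟨(dfAdj adj).fullyFaithfulLOfCompIsoId (dfComp F G ≪≫ dfMapIso e ≪≫ dfId)⟩

lemma df_ff_right {F : A ⥤ B} {G : B ⥤ A} [Ex F] [Ex G] (adj : F ⊣ G) (e : G ⋙ F ≅ 𝟭 B) :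
    Nonempty (DF G).FullyFaithful :=
  ⟨(dfAdj adj).fullyFaithfulROfCompIsoId (dfComp G F ≪≫ dfMapIso e ≪≫ dfId)⟩

lemma df_iso_of_joint (F : A ⥤ B) [Ex F] (G : A ⥤ C) [Ex G]
    (h : ∀ X, IsZero (F.obj X) → IsZero (G.obj X) → IsZero X) {X Y : DerivedCategory A} (f : X ⟶ Y)
    [IsIso ((DF F).map f)] [IsIso ((DF G).map f)] : IsIso f := by
  obtain ⟨Z, g, k, ht⟩ := distinguished_cocone_triangle f
  have z : IsZero Z := by
    apply df_joint_zero F G h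
    · have := (DF F).map_distinguished _ ht
      exact (Triangle.isZero₃_iff_isIso₁ _ this).2 (inferInstanceAs (IsIso ((DF F).map f)))
    · have := (DF G).map_distinguished _ ht
      exact (Triangle.isZero₃_iff_isIso₁ _ this).2 (inferInstanceAs (IsIso ((DF G).map f)))
  exact (Triangle.isZero₃_iff_isIso₁ _ ht).1 z

lemma isIso_of_zero {D : Type*} [Category D] {X Y : D} (f : X ⟶ Y) (hX : IsZero X) (hY : IsZero Y) :
    IsIso f := ⟨hY.to_ X, hX.eq_of_src _ _, hY.eq_of_src _ _⟩

/-- form 1 : `J ⊣ ev1`. -/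
lemma df_in_image_left {J : B ⥤ A} {ev1 : A ⥤ B} [Ex J] [Ex ev1] (adj : J ⊣ ev1)
    (e : J ⋙ ev1 ≅ 𝟭 B) (ev0 : A ⥤ C) [Ex ev0] (h0 : ∀ X, IsZero (ev0.obj (J.obj X)))
    (h : ∀ X, IsZero (ev0.obj X) → IsZero (ev1.obj X) → IsZero X) (X : DerivedCategory A)
    (hX : IsZero ((DF ev0).obj X)) : ∃ Y, Nonempty (X ≅ (DF J).obj Y) := by
  obtain ⟨ff⟩ := df_ff_left adj e
  have := ff.full; have := ff.faithful
  have i1 : IsIso ((DF ev1).map ((dfAdj adj).counit.app X)) := by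
    have := (dfAdj adj).right_triangle_components X
    exact IsIso.of_isIso_fac_left this
  have i0 : IsIso ((DF ev0).map ((dfAdj adj).counit.app X)) :=
    isIso_of_zero _ (isZero_of_comp_zero J ev0 h0 _) hX
  have := df_iso_of_joint ev0 ev1 h ((dfAdj adj).counit.app X)
  exact ⟨_, ⟨(asIso ((dfAdj adj).counit.app X)).symm⟩⟩

lemma df_in_image_right {J : B ⥤ A} {ev1 : A ⥤ B} [Ex J] [Ex ev1] (adj : ev1 ⊣ J)
    (e : J ⋙ ev1 ≅ 𝟭 B) (ev0 : A ⥤ C) [Ex ev0] (h0 : ∀ X, IsZero (ev0.obj (J.obj X)))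
    (h : ∀ X, IsZero (ev0.obj X) → IsZero (ev1.obj X) → IsZero X) (X : DerivedCategory A)
    (hX : IsZero ((DF ev0).obj X)) : ∃ Y, Nonempty (X ≅ (DF J).obj Y) := by
  obtain ⟨ff⟩ := df_ff_right adj e
  have := ff.full; have := ff.faithful
  have i1 : IsIso ((DF ev1).map ((dfAdj adj).unit.app X)) := by
    have := (dfAdj adj).left_triangle_components X
    exact @IsIso.of_isIso_fac_right _ _ _ _ _ _ _ _ inferInstance (IsIso.id _) this
  have i0 : IsIso ((DF ev0).map ((dfAdj adj).unit.app X)) :=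
    isIso_of_zero _ hX (isZero_of_comp_zero J ev0 h0 _)
  have := df_iso_of_joint ev0 ev1 h ((dfAdj adj).unit.app X)
  exact ⟨_, ⟨asIso ((dfAdj adj).unit.app X)⟩⟩

end

section Tri
variable {S : Type u₁} [Category.{v₁} S] [Preadditive S] [HasZeroObject S] [HasShift S ℤ]
  [∀ n : ℤ, (shiftFunctor S n).Additive] [Pretriangulated S]
  {T : Type u₂} [Category.{v₂} T] [Preadditive T] [HasZeroObject T] [HasShift T ℤ]
  [∀ n : ℤ, (shiftFunctor T n).Additive] [Pretriangulated T]

lemma adj_hom_zero_left {F : S ⥤ T} {G : T ⥤ S} (adj : F ⊣ G) {X : S} {Y : T}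
    (h : IsZero (G.obj Y)) (f : F.obj X ⟶ Y) : f = 0 :=
  (adj.homEquiv X Y).injective (h.eq_of_tgt _ _)

lemma adj_hom_zero_right {F : S ⥤ T} {G : T ⥤ S} (adj : F ⊣ G) {X : S} {Y : T}
    (h : IsZero (F.obj X)) (f : X ⟶ G.obj Y) : f = 0 :=
  (adj.homEquiv X Y).symm.injective (h.eq_of_src _ _)

lemma hom_zero_iso {X X' Y Y' : S} (e : X ≅ X') (i : Y ≅ Y') (h : ∀ f : X ⟶ Y, f = 0)
    (f : X' ⟶ Y') : f = 0 := by
  have := h (e.hom ≫ f ≫ i.inv)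
  rw [← cancel_epi e.hom, ← cancel_mono i.inv, Category.assoc, this]; simp

lemma Bij.of_comp {R : Type u₃} [Category.{v₃} R] {G : R ⥤ S} (hG : G.FullyFaithful) {F : S ⥤ T}
    {K : R ⥤ T} (e : G ⋙ F ≅ K) (hK : K.FullyFaithful) (X Y : R) : Bij F (G.obj X) (G.obj Y) := by
  have ff := hK.ofIso e.symm
  have h1 : Function.Bijective ((G ⋙ F).map : (X ⟶ Y) → _) := ff.map_bijective X Y
  have h2 : Function.Bijective (G.map : (X ⟶ Y) → _) := hG.map_bijective X Y
  have h3 : ((G ⋙ F).map : (X ⟶ Y) → _) = (fun f => F.map f) ∘ (fun f => G.map f) := rfl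
  rw [h3] at h1
  exact (Function.Bijective.of_comp_iff _ h2).1 h1

lemma Bij.comp {R : Type u₃} [Category.{v₃} R] [Preadditive R] [HasZeroObject R] [HasShift R ℤ]
    [∀ n : ℤ, (shiftFunctor R n).Additive] [Pretriangulated R]
    {F : R ⥤ S} {G : S ⥤ T} {X Y : R} (h : Bij F X Y)
    (h' : Bij G (F.obj X) (F.obj Y)) : Bij (F ⋙ G) X Y :=
  Function.Bijective.comp (g := fun f : F.obj X ⟶ F.obj Y => G.map f) h' h

end Tri
end NakE7

-- Part 5

namespace NakE7
open Limits Pretriangulated ZeroObject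

universe v₁ v₂ v₃ v₄ u₁ u₂ u₃ u₄

section
variable {A : Type u₁} [Category.{v₁} A] [Abelian A] {B : Type u₂} [Category.{v₂} B] [Abelian B]
  {C : Type u₃} [Category.{v₃} C] [Abelian C]

lemma tri_iso₃ {S : Type u₁} [Category.{v₁} S] [Preadditive S] [HasZeroObject S] [HasShift S ℤ]
    [∀ n : ℤ, (shiftFunctor S n).Additive] [Pretriangulated S] {X Y Z Z' : S} (f : X ⟶ Y) (g : Y ⟶ Z)
    (h : Z ⟶ X⟦(1:ℤ)⟧) (e : Z ≅ Z') (ht : Triangle.mk f g h ∈ distTriang S) :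
    Triangle.mk f (g ≫ e.hom) (e.inv ≫ h) ∈ distTriang S := by
  refine isomorphic_distinguished _ ht _ (Triangle.isoMk _ _ (Iso.refl _) (Iso.refl _) e.symm ?_ ?_ ?_)
  · show f ≫ 𝟙 _ = 𝟙 _ ≫ f
    simp
  · show (g ≫ e.hom) ≫ e.inv = 𝟙 _ ≫ g
    simp
  · show (e.inv ≫ h) ≫ (shiftFunctor S (1:ℤ)).map (𝟙 X) = e.inv ≫ h
    simp

section gen
variable (L : A ⥤ C) (R : B ⥤ C) [Ex L] [Ex R]

noncomputable def inL : A ⥤ Comma L R where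
  obj X := ⟨X, 0, 0⟩
  map f := { left := f, right := 0, w := by simp }
  map_id X := by apply CommaMorphism.ext; rfl; exact (isZero_zero B).eq_of_src _ _
  map_comp f g := by apply CommaMorphism.ext; rfl; exact (isZero_zero B).eq_of_src _ _

noncomputable def inR : B ⥤ Comma L R where
  obj X := ⟨0, X, 0⟩
  map f := { left := 0, right := f, w := by simp }
  map_id X := by apply CommaMorphism.ext; exact (isZero_zero A).eq_of_src _ _; rfl
  map_comp f g := by apply CommaMorphism.ext; exact (isZero_zero A).eq_of_src _ _; rfl

noncomputable def inRsnd : inR L R ⋙ Comma.snd L R ≅ 𝟭 B := Iso.refl _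
noncomputable def inLfst : inL L R ⋙ Comma.fst L R ≅ 𝟭 A := Iso.refl _
lemma inRfst (X) : IsZero ((Comma.fst L R).obj ((inR L R).obj X)) := isZero_zero A
lemma inLsnd (X) : IsZero ((Comma.snd L R).obj ((inL L R).obj X)) := isZero_zero B

instance Ex.inL : Ex (inL L R) := Ex.comma _ _ _ (inferInstanceAs (Ex (𝟭 A)))
  (Ex.of_zero _ (inLsnd L R))
instance Ex.inR : Ex (inR L R) := Ex.comma _ _ _ (Ex.of_zero _ (inRfst L R))
  (inferInstanceAs (Ex (𝟭 B)))

lemma isZero_map (F : A ⥤ C) [Ex F] {X : A} (h : IsZero X) : IsZero (F.obj X) := F.map_isZero h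

noncomputable def inRAdj : inR L R ⊣ Comma.snd L R :=
  Adjunction.mkOfHomEquiv
    { homEquiv := fun X Y =>
        { toFun := fun f => f.right
          invFun := fun f => { left := 0, right := f,
                               w := (isZero_map L (isZero_zero A)).eq_of_src _ _ }
          left_inv := fun f => by apply CommaMorphism.ext; exact (isZero_zero A).eq_of_src _ _; rfl
          right_inv := fun f => rfl }
      homEquiv_naturality_left_symm := fun f g => by
        apply CommaMorphism.ext; exact (isZero_zero A).eq_of_src _ _; rfl
      homEquiv_naturality_right := fun f g => rfl }

noncomputable def inLAdj : Comma.fst L R ⊣ inL L R :=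
  Adjunction.mkOfHomEquiv
    { homEquiv := fun X Y =>
        { toFun := fun f => { left := f, right := 0,
                               w := (isZero_map R (isZero_zero B)).eq_of_tgt _ _ }
          invFun := fun f => f.left
          left_inv := fun f => rfl
          right_inv := fun f => by
            apply CommaMorphism.ext; rfl; exact (isZero_zero B).eq_of_tgt _ _ }
      homEquiv_naturality_left_symm := fun f g => rfl
      homEquiv_naturality_right := fun f g => by
        apply CommaMorphism.ext; rfl; exact (isZero_zero B).eq_of_tgt _ _ }

end gen

variable (H : A ⥤ C) [Ex H]

/-- `X ↦ (H X = H X)` -/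
def bR : A ⥤ Comma (𝟭 C) H where
  obj X := ⟨H.obj X, X, 𝟙 _⟩
  map f := { left := H.map f, right := f, w := by simp }

def bL : A ⥤ Comma H (𝟭 C) where
  obj X := ⟨X, H.obj X, 𝟙 _⟩
  map f := { left := f, right := H.map f, w := by simp }

def bRAdj : Comma.snd (𝟭 C) H ⊣ bR H :=
  Adjunction.mkOfHomEquiv
    { homEquiv := fun X Y =>
        { toFun := fun f => { left := X.hom ≫ H.map f, right := f, w := by simp [bR] }
          invFun := fun f => f.right
          left_inv := fun f => rfl
          right_inv := fun f => by
            apply CommaMorphism.ext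
            · have := f.w; simp [bR] at this; simp; exact this.symm
            · rfl }
      homEquiv_naturality_left_symm := fun f g => rfl
      homEquiv_naturality_right := fun f g => by
        apply CommaMorphism.ext
        · show _ ≫ H.map (f ≫ g) = (_ ≫ H.map f) ≫ H.map g
          rw [H.map_comp, Category.assoc]
        · rfl }

def bLAdj : bL H ⊣ Comma.fst H (𝟭 C) :=
  Adjunction.mkOfHomEquiv
    { homEquiv := fun X Y =>
        { toFun := fun f => f.left
          invFun := fun f => { left := f, right := H.map f ≫ Y.hom, w := by simp [bL] }
          left_inv := fun f => by
            apply CommaMorphism.ext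
            · rfl
            · have := f.w; simp [bL] at this; simp; exact this
          right_inv := fun f => rfl }
      homEquiv_naturality_left_symm := fun f g => by
        apply CommaMorphism.ext
        · rfl
        · show H.map (f ≫ g) ≫ _ = H.map f ≫ H.map g ≫ _
          rw [H.map_comp, Category.assoc]
      homEquiv_naturality_right := fun f g => rfl }

lemma bLAdj_counit_left (X) : ((bLAdj H).counit.app X).left = 𝟙 _ := rfl
lemma bLAdj_counit_right (X) : ((bLAdj H).counit.app X).right = X.hom := by
  show H.map (𝟙 _) ≫ X.hom = X.hom
  simp

def bRsnd : bR H ⋙ Comma.snd _ _ ≅ 𝟭 A := Iso.refl _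
def bRfst : bR H ⋙ Comma.fst _ _ ≅ H := Iso.refl _
def bLfst : bL H ⋙ Comma.fst _ _ ≅ 𝟭 A := Iso.refl _
def bLsnd : bL H ⋙ Comma.snd _ _ ≅ H := Iso.refl _

instance Ex.bR : Ex (bR H) := Ex.comma _ _ _ (inferInstanceAs (Ex H)) (inferInstanceAs (Ex (𝟭 A)))
instance Ex.bL : Ex (bL H) := Ex.comma _ _ _ (inferInstanceAs (Ex (𝟭 A))) (inferInstanceAs (Ex H))

variable (B)
/-- arrow category -/
abbrev Arr := Comma (𝟭 B) (𝟭 B)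
noncomputable abbrev arJ : B ⥤ Arr B := inR _ _
noncomputable abbrev arI : B ⥤ Arr B := inL _ _
abbrev arD : B ⥤ Arr B := bL (𝟭 B)
abbrev ev0 : Arr B ⥤ B := Comma.fst _ _
abbrev ev1 : Arr B ⥤ B := Comma.snd _ _
abbrev arDAdj : arD B ⊣ ev0 B := bLAdj (𝟭 B)
abbrev arDAdj' : ev1 B ⊣ arD B := bRAdj (𝟭 B)

lemma arr_refl (w : DerivedCategory (Arr B)) :
    ∃ (v : DerivedCategory B) (g : w ⟶ (DF (arJ B)).obj v)
      (h : (DF (arJ B)).obj v ⟶ ((DF (arD B)).obj ((DF (ev0 B)).obj w))⟦(1:ℤ)⟧),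
      (Triangle.mk ((dfAdj (arDAdj B)).counit.app w) g h ∈ distTriang _) ∧
      IsRefl (DF (arJ B)) g := by
  obtain ⟨Z, g, h, ht⟩ := distinguished_cocone_triangle ((dfAdj (arDAdj B)).counit.app w)
  have z : IsZero ((DF (ev0 B)).obj Z) := by
    have h1 := (DF (ev0 B)).map_distinguished _ ht
    refine (Triangle.isZero₃_iff_isIso₁ _ h1).2 ?_
    show IsIso ((DF (ev0 B)).map ((dfAdj (arDAdj B)).counit.app w))
    obtain ⟨ff⟩ := df_ff_left (arDAdj B) (bLfst _)
    have := ff.full; have := ff.faithful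
    exact IsIso.of_isIso_fac_left ((dfAdj (arDAdj B)).right_triangle_components w)
  obtain ⟨v, ⟨e⟩⟩ := df_in_image_left (inRAdj (𝟭 B) (𝟭 B)) (inRsnd _ _) (ev0 B) (inRfst _ _)
    (fun X h1 h2 => comma_zero _ _ _ h1 h2) Z z
  obtain ⟨ff⟩ := df_ff_left (inRAdj (𝟭 B) (𝟭 B)) (inRsnd _ _)
  have := ff.full; have := ff.faithful
  have ht' : Triangle.mk ((dfAdj (arDAdj B)).counit.app w) (g ≫ e.hom) (e.inv ≫ h) ∈ distTriang _ :=
    tri_iso₃ _ _ _ e ht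
  refine ⟨v, g ≫ e.hom, e.inv ≫ h, ht', ?_⟩
  refine isRefl_of_tri (DF (arJ B)) _ _ _ ht' ?_
  intro v' x
  exact adj_hom_zero_left (dfAdj (arDAdj B)) (isZero_of_comp_zero _ _ (inRfst _ _) _) x

end
end NakE7

-- Part 6

namespace NakE7
open Limits Pretriangulated ZeroObject

universe v₁ v₂ v₃ v₄ u₁ u₂ u₃ u₄

section
variable (B : Type u₂) [Category.{v₂} B] [Abelian B]

lemma arr_lam : ∃ (l : DerivedCategory (Arr B) ⥤ DerivedCategory B) (c : l.CommShift ℤ)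
    (_ : l.IsTriangulated), Nonempty (l ⊣ DF (arJ B)) := by
  have : (DF (arJ B)).IsRightAdjoint := isRightAdjoint_of_refl _ (fun w => by
    obtain ⟨v, g, h, h1, h2⟩ := arr_refl B w
    exact ⟨v, g, h2⟩)
  let adj := Adjunction.ofIsRightAdjoint (DF (arJ B))
  letI c : (DF (arJ B)).leftAdjoint.CommShift ℤ := adj.leftAdjointCommShift ℤ
  haveI : adj.CommShift ℤ := adj.commShift_of_rightAdjoint ℤ
  exact ⟨_, c, adj.isTriangulated_leftAdjoint, ⟨adj⟩⟩

variable {B}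
variable {l : DerivedCategory (Arr B) ⥤ DerivedCategory B}

lemma lam_tri (adj : l ⊣ DF (arJ B)) (w : DerivedCategory (Arr B)) :
    ∃ (g : w ⟶ (DF (arJ B)).obj (l.obj w))
      (h : (DF (arJ B)).obj (l.obj w) ⟶ ((DF (arD B)).obj ((DF (ev0 B)).obj w))⟦(1:ℤ)⟧),
      (Triangle.mk ((dfAdj (arDAdj B)).counit.app w) g h ∈ distTriang _) ∧
      IsRefl (DF (arJ B)) g := by
  obtain ⟨v, g, h, h1, h2⟩ := arr_refl B w
  obtain ⟨e, he⟩ := refl_unit_iso _ adj h2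
  have h3 := tri_iso₃ _ _ _ ((DF (arJ B)).mapIso e.symm) h1
  refine ⟨_, _, h3, ?_⟩
  intro v'
  have : (fun s : l.obj w ⟶ v' => (g ≫ ((DF (arJ B)).mapIso e.symm).hom) ≫ (DF (arJ B)).map s) =
      (fun s => g ≫ (DF (arJ B)).map s) ∘ (fun s => e.inv ≫ s) := by
    funext s
    simp
  exact this ▸ (h2 v').comp ⟨fun a b hab => (cancel_epi e.inv).1 hab, fun a => ⟨e.hom ≫ a, by simp⟩⟩

lemma lam_zero (adj : l ⊣ DF (arJ B)) {C : Type u₃} [Category.{v₃} C] [Abelian C] (N : B ⥤ C) [Ex N]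
    (w : DerivedCategory (Arr B))
    (h : IsIso ((DF (ev1 B ⋙ N)).map ((dfAdj (arDAdj B)).counit.app w))) :
    IsZero ((DF N).obj (l.obj w)) := by
  obtain ⟨g, k, ht, -⟩ := lam_tri adj w
  have h1 := (DF (ev1 B ⋙ N)).map_distinguished _ ht
  have h2 : IsZero ((DF (ev1 B ⋙ N)).obj ((DF (arJ B)).obj (l.obj w))) :=
    (Triangle.isZero₃_iff_isIso₁ _ h1).2 h
  refine h2.of_iso ((dfCompIso (F := arJ B) (G := ev1 B ⋙ N) (H := N) ?_).symm.app (l.obj w))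
  exact Iso.refl _

lemma lam_I (adj : l ⊣ DF (arJ B)) (z : DerivedCategory B) : Nonempty (l.obj ((DF (arI B)).obj z) ≅ z⟦(1:ℤ)⟧) := by
  obtain ⟨g, k, ht, -⟩ := lam_tri adj ((DF (arI B)).obj z)
  have h1 := (DF (ev1 B)).map_distinguished _ ht
  have h2 : IsIso ((DF (ev1 B)).mapTriangle.obj (Triangle.mk _ g k)).mor₃ :=
    (Triangle.isZero₂_iff_isIso₃ _ h1).1 (isZero_of_comp_zero _ _ (inLsnd _ _) _)
  let e1 : (DF (ev1 B)).obj ((DF (arJ B)).obj (l.obj ((DF (arI B)).obj z))) ≅ _ :=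
    @asIso _ _ _ _ _ h2
  let e0 : (DF (ev1 B)).obj ((DF (arJ B)).obj (l.obj ((DF (arI B)).obj z))) ≅
    l.obj ((DF (arI B)).obj z) := ((dfCompIso (F := arJ B) (G := ev1 B) (H := 𝟭 B) (Iso.refl _)) ≪≫ dfId).app _
  let e2 : (DF (ev1 B)).obj ((DF (arD B)).obj ((DF (ev0 B)).obj ((DF (arI B)).obj z))) ≅ z :=
    ((dfCompIso (F := arD B) (G := ev1 B) (H := 𝟭 B) (Iso.refl _)) ≪≫ dfId).app _ ≪≫
    ((dfCompIso (F := arI B) (G := ev0 B) (H := 𝟭 B) (Iso.refl _)) ≪≫ dfId).app _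
  exact ⟨e0.symm ≪≫ e1 ≪≫ (shiftFunctor _ (1:ℤ)).mapIso e2⟩

lemma lam_I_bij (adj : l ⊣ DF (arJ B)) (z z' : DerivedCategory B) : Bij l ((DF (arI B)).obj z) ((DF (arI B)).obj z') := by
  obtain ⟨g, k, ht, hg⟩ := lam_tri adj ((DF (arI B)).obj z')
  refine refl_bij _ adj _ _ _ ht hg ?_ ?_
  · intro x
    exact adj_hom_zero_right (dfAdj (arDAdj' B)) (isZero_of_comp_zero _ _ (inLsnd _ _) _) x
  · apply hom_zero_iso (Iso.refl _) (((DF (arD B)).commShiftIso (1:ℤ)).app _)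
    intro x
    exact adj_hom_zero_right (dfAdj (arDAdj' B)) (isZero_of_comp_zero _ _ (inLsnd _ _) _) x

lemma lam_J (adj : l ⊣ DF (arJ B)) : Nonempty (DF (arJ B) ⋙ l ≅ 𝟭 _) := by
  obtain ⟨ff⟩ := df_ff_left (inRAdj (𝟭 B) (𝟭 B)) (inRsnd _ _)
  have := ff.full; have := ff.faithful
  exact ⟨asIso adj.counit⟩
end

section
variable {A : Type u₁} [Category.{v₁} A] [Abelian A]
  {C : Type u₃} [Category.{v₃} C] [Abelian C] (H : A ⥤ C) [Ex H]

noncomputable def psi : Comma (𝟭 C) H ⥤ Arr (Comma H (𝟭 C)) where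
  obj e := ⟨(inR H (𝟭 C)).obj e.left, (bL H).obj e.right,
    { left := 0, right := e.hom, w := (isZero_map H (isZero_zero A)).eq_of_src _ _ }⟩
  map {e e'} f :=
    { left := (inR H (𝟭 C)).map f.left
      right := (bL H).map f.right
      w := by
        apply CommaMorphism.ext
        · exact (isZero_zero A).eq_of_src _ _
        · exact f.w }
  map_id e := by
    apply CommaMorphism.ext
    · exact (inR H (𝟭 C)).map_id _
    · exact (bL H).map_id _
  map_comp f g := by
    apply CommaMorphism.ext
    · exact (inR H (𝟭 C)).map_comp _ _
    · exact (bL H).map_comp _ _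

instance exPsi : Ex (psi H) := Ex.comma _ _ _
  (inferInstanceAs (Ex (Comma.fst _ _ ⋙ inR H (𝟭 C)))) (inferInstanceAs (Ex (Comma.snd _ _ ⋙ bL H)))

noncomputable def psiC : inR (𝟭 C) H ⋙ psi H ≅ bL H ⋙ arJ _ :=
  NatIso.ofComponents (fun X => Comma.isoMk
    ((isZero_map (inR H (𝟭 C)) (isZero_zero C)).iso (isZero_zero _)) (Iso.refl _)
    ((isZero_map (inR H (𝟭 C)) (isZero_zero C)).eq_of_src _ _))
    (fun f => by
      apply CommaMorphism.ext
      · exact (isZero_map (inR H (𝟭 C)) (isZero_zero C)).eq_of_src _ _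
      · show (bL H).map f ≫ 𝟙 _ = 𝟙 _ ≫ (bL H).map f
        simp)

noncomputable def psiA : inL (𝟭 C) H ⋙ psi H ≅ inR H (𝟭 C) ⋙ arI _ :=
  NatIso.ofComponents (fun X => Comma.isoMk (Iso.refl _)
    ((isZero_map (bL H) (isZero_zero A)).iso (isZero_zero _))
    ((isZero_zero _).eq_of_tgt _ _))
    (fun f => by
      apply CommaMorphism.ext
      · show (inR H (𝟭 C)).map f ≫ 𝟙 _ = 𝟙 _ ≫ (inR H (𝟭 C)).map f
        simp
      · exact (isZero_zero _).eq_of_tgt _ _)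

end
end NakE7

-- Part 7

namespace NakE7
open Limits Pretriangulated ZeroObject

universe v₁ v₂ v₃ v₄ u₁ u₂ u₃ u₄

/-- triangle equivalence of derived categories -/
def TE (A : Type u₁) [Category.{v₁} A] [Abelian A] (B : Type u₂) [Category.{v₂} B] [Abelian B] : Prop :=
  ∃ (F : DerivedCategory A ⥤ DerivedCategory B) (c : F.CommShift ℤ), haveI := c;
    (F.IsTriangulated ∧ F.IsEquivalence)

lemma TE.symm {A : Type u₁} [Category.{v₁} A] [Abelian A] {B : Type u₂} [Category.{v₂} B] [Abelian B]
    (h : TE A B) : TE B A := by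
  obtain ⟨F, c, h1, h2⟩ := h
  let E := F.asEquivalence
  letI : E.functor.CommShift ℤ := c
  letI c2 : E.inverse.CommShift ℤ := E.commShiftInverse ℤ
  haveI : E.CommShift ℤ := E.commShift_of_functor ℤ
  haveI : E.IsTriangulated := Equivalence.IsTriangulated.mk' E h1
  exact ⟨E.inverse, c2, inferInstance, inferInstance⟩

lemma TE.trans {A : Type u₁} [Category.{v₁} A] [Abelian A] {B : Type u₂} [Category.{v₂} B] [Abelian B]
    {C : Type u₃} [Category.{v₃} C] [Abelian C] (h : TE A B) (h' : TE B C) : TE A C := by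
  obtain ⟨F, c, h1, h2⟩ := h
  obtain ⟨G, d, h3, h4⟩ := h'
  exact ⟨F ⋙ G, inferInstance, inferInstance, inferInstance⟩

lemma TE.of_equiv {A : Type u₁} [Category.{v₁} A] [Abelian A] {B : Type u₂} [Category.{v₂} B] [Abelian B]
    (e : A ≌ B) : TE A B := by
  have h1 : e.functor.Additive := Functor.additive_of_preserves_binary_products _
  have h2 : e.inverse.Additive := Functor.additive_of_preserves_binary_products _
  haveI : Ex e.functor := ⟨h1, inferInstance, inferInstance⟩
  haveI : Ex e.inverse := ⟨h2, inferInstance, inferInstance⟩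
  let E : DerivedCategory A ≌ DerivedCategory B := CategoryTheory.Equivalence.mk (DF e.functor) (DF e.inverse)
    ((dfCompIso (F := e.functor) (G := e.inverse) e.unitIso.symm ≪≫ dfId).symm)
    (dfCompIso (F := e.inverse) (G := e.functor) e.counitIso ≪≫ dfId)
  exact ⟨DF e.functor, inferInstance, inferInstance, E.isEquivalence_functor⟩

lemma TE.refl (A : Type u₁) [Category.{v₁} A] [Abelian A] : TE A A :=
  TE.of_equiv CategoryTheory.Equivalence.refl

section
variable {A : Type u₁} [Category.{v₁} A] [Abelian A]
  {C : Type u₃} [Category.{v₃} C] [Abelian C] (H : A ⥤ C) [Ex H]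

/-- decomposition c' -> e -> a' -/
lemma decomp1 (e : DerivedCategory (Comma (𝟭 C) H)) :
    ∃ (X : DerivedCategory A) (Y : DerivedCategory C) (f : (DF (inR (𝟭 C) H)).obj X ⟶ e)
      (g : e ⟶ (DF (inL (𝟭 C) H)).obj Y) (h : _ ⟶ _), Triangle.mk f g h ∈ distTriang _ := by
  obtain ⟨Z, g, h, ht⟩ := distinguished_cocone_triangle ((dfAdj (inRAdj (𝟭 C) H)).counit.app e)
  have z : IsZero ((DF (Comma.snd (𝟭 C) H)).obj Z) := by
    have h1 := (DF (Comma.snd (𝟭 C) H)).map_distinguished _ ht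
    refine (Triangle.isZero₃_iff_isIso₁ _ h1).2 ?_
    show IsIso ((DF (Comma.snd (𝟭 C) H)).map ((dfAdj (inRAdj (𝟭 C) H)).counit.app e))
    obtain ⟨ff⟩ := df_ff_left (inRAdj (𝟭 C) H) (inRsnd _ _)
    have := ff.full; have := ff.faithful
    exact IsIso.of_isIso_fac_left ((dfAdj (inRAdj (𝟭 C) H)).right_triangle_components e)
  obtain ⟨Y, ⟨i⟩⟩ := df_in_image_right (inLAdj (𝟭 C) H) (inLfst _ _) (Comma.snd _ _) (inLsnd _ _)
    (fun X h1 h2 => comma_zero _ _ _ h2 h1) Z z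
  exact ⟨_, Y, _, _, _, tri_iso₃ _ _ _ i ht⟩

lemma tri_iso₁ {S : Type u₁} [Category.{v₁} S] [Preadditive S] [HasZeroObject S] [HasShift S ℤ]
    [∀ n : ℤ, (shiftFunctor S n).Additive] [Pretriangulated S] {X X' Y Z : S} (f : X ⟶ Y) (g : Y ⟶ Z)
    (h : Z ⟶ X⟦(1:ℤ)⟧) (e : X ≅ X') (ht : Triangle.mk f g h ∈ distTriang S) :
    Triangle.mk (e.inv ≫ f) g (h ≫ (shiftFunctor S (1:ℤ)).map e.hom) ∈ distTriang S := by
  refine isomorphic_distinguished _ ht _ (Triangle.isoMk _ _ e.symm (Iso.refl _) (Iso.refl _) ?_ ?_ ?_)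
  · show (e.inv ≫ f) ≫ 𝟙 _ = e.inv ≫ f
    simp
  · show g ≫ 𝟙 _ = 𝟙 _ ≫ g
    simp
  · show (h ≫ (shiftFunctor S (1:ℤ)).map e.hom) ≫ (shiftFunctor S (1:ℤ)).map e.inv = 𝟙 _ ≫ h
    rw [Category.assoc, ← Functor.map_comp]
    simp

/-- decomposition a' -> e -> b' -/
lemma decomp2 (e : DerivedCategory (Comma (𝟭 C) H)) :
    ∃ (X : DerivedCategory A) (Y : DerivedCategory C) (f : (DF (inL (𝟭 C) H)).obj Y ⟶ e)
      (g : e ⟶ (DF (bR H)).obj X) (h : _ ⟶ _), Triangle.mk f g h ∈ distTriang _ := by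
  obtain ⟨Z, g, h, ht⟩ := distinguished_cocone_triangle₁ ((dfAdj (bRAdj H)).unit.app e)
  have z : IsZero ((DF (Comma.snd (𝟭 C) H)).obj Z) := by
    have h1 := (DF (Comma.snd (𝟭 C) H)).map_distinguished _ ht
    refine (Triangle.isZero₁_iff_isIso₂ _ h1).2 ?_
    show IsIso ((DF (Comma.snd (𝟭 C) H)).map ((dfAdj (bRAdj H)).unit.app e))
    obtain ⟨ff⟩ := df_ff_right (bRAdj H) (bRsnd _)
    have := ff.full; have := ff.faithful
    exact @IsIso.of_isIso_fac_right _ _ _ _ _ _ _ _ inferInstance (IsIso.id _)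
      ((dfAdj (bRAdj H)).left_triangle_components e)
  obtain ⟨Y, ⟨i⟩⟩ := df_in_image_right (inLAdj (𝟭 C) H) (inLfst _ _) (Comma.snd _ _) (inLsnd _ _)
    (fun X h1 h2 => comma_zero _ _ _ h2 h1) Z z
  exact ⟨_, Y, _, _, _, tri_iso₁ _ _ _ i ht⟩

/-- decomposition b -> e -> a in E1 -/
lemma decomp3 (e : DerivedCategory (Comma H (𝟭 C))) :
    ∃ (X : DerivedCategory A) (Y : DerivedCategory C) (f : (DF (bL H)).obj X ⟶ e)
      (g : e ⟶ (DF (inR H (𝟭 C))).obj Y) (h : _ ⟶ _), Triangle.mk f g h ∈ distTriang _ := by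
  obtain ⟨Z, g, h, ht⟩ := distinguished_cocone_triangle ((dfAdj (bLAdj H)).counit.app e)
  have z : IsZero ((DF (Comma.fst H (𝟭 C))).obj Z) := by
    have h1 := (DF (Comma.fst H (𝟭 C))).map_distinguished _ ht
    refine (Triangle.isZero₃_iff_isIso₁ _ h1).2 ?_
    show IsIso ((DF (Comma.fst H (𝟭 C))).map ((dfAdj (bLAdj H)).counit.app e))
    obtain ⟨ff⟩ := df_ff_left (bLAdj H) (bLfst _)
    have := ff.full; have := ff.faithful
    exact IsIso.of_isIso_fac_left ((dfAdj (bLAdj H)).right_triangle_components e)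
  obtain ⟨Y, ⟨i⟩⟩ := df_in_image_left (inRAdj H (𝟭 C)) (inRsnd _ _) (Comma.fst _ _) (inRfst _ _)
    (fun X h1 h2 => comma_zero _ _ _ h1 h2) Z z
  exact ⟨_, Y, _, _, _, tri_iso₃ _ _ _ i ht⟩

theorem lemmaR : TE (Comma (𝟭 C) H) (Comma H (𝟭 C)) := by
  obtain ⟨l, c, tr, ⟨adj⟩⟩ := arr_lam (Comma H (𝟭 C))
  let Λ : DerivedCategory (Comma (𝟭 C) H) ⥤ DerivedCategory (Comma H (𝟭 C)) := DF (psi H) ⋙ l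
  obtain ⟨lJ⟩ := lam_J adj
  obtain ⟨ffc⟩ := df_ff_left (inRAdj (𝟭 C) H) (inRsnd _ _)
  obtain ⟨ffb⟩ := df_ff_left (bLAdj H) (bLfst _)
  obtain ⟨ffa⟩ := df_ff_left (inRAdj H (𝟭 C)) (inRsnd _ _)
  obtain ⟨ffa'⟩ := df_ff_right (inLAdj (𝟭 C) H) (inLfst _ _)
  obtain ⟨ffI⟩ := df_ff_right (inLAdj (𝟭 (Comma H (𝟭 C))) (𝟭 (Comma H (𝟭 C)))) (inLfst _ _)
  let iA : DF (inL (𝟭 C) H) ⋙ DF (psi H) ≅ DF (inR H (𝟭 C)) ⋙ DF (arI (Comma H (𝟭 C))) :=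
    dfCompIso (psiA H) ≪≫ (dfComp _ _).symm
  let iC : DF (inR (𝟭 C) H) ⋙ Λ ≅ DF (bL H) :=
    (Functor.associator _ _ _).symm ≪≫
      Functor.isoWhiskerRight (dfCompIso (psiC H) ≪≫ (dfComp _ _).symm) l ≪≫
      Functor.associator _ _ _ ≪≫ Functor.isoWhiskerLeft _ lJ ≪≫ Functor.rightUnitor _
  -- Λ a' Y ≅ (aY)[1]
  have lamA : ∀ Y, Nonempty (Λ.obj ((DF (inL (𝟭 C) H)).obj Y) ≅ ((DF (inR H (𝟭 C))).obj Y)⟦(1:ℤ)⟧) := by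
    intro Y
    obtain ⟨e⟩ := lam_I adj ((DF (inR H (𝟭 C))).obj Y)
    exact ⟨l.mapIso (iA.app Y) ≪≫ e⟩
  have cc : ∀ X X', Bij Λ ((DF (inR (𝟭 C) H)).obj X) ((DF (inR (𝟭 C) H)).obj X') :=
    fun X X' => Bij.of_comp ffc iC ffb X X'
  have aa : ∀ Y Y', Bij Λ ((DF (inL (𝟭 C) H)).obj Y) ((DF (inL (𝟭 C) H)).obj Y') := by
    intro Y Y'
    apply Bij.comp
    · exact Bij.of_comp ffa' iA (ffa.comp ffI) Y Y'
    · exact ((lam_I_bij adj _ _).iso_left (iA.app Y).symm).iso_right (iA.app Y').symm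
  have ca : ∀ X Y', Bij Λ ((DF (inR (𝟭 C) H)).obj X) ((DF (inL (𝟭 C) H)).obj Y') := by
    intro X Y'
    apply Bij.of_zero
    · intro f
      exact adj_hom_zero_left (dfAdj (inRAdj (𝟭 C) H)) (isZero_of_comp_zero _ _ (inLsnd _ _) _) f
    · apply hom_zero_iso (iC.app X).symm (lamA Y').some.symm
      intro f
      refine adj_hom_zero_left (dfAdj (bLAdj H)) ?_ f
      exact ((shiftFunctor _ (1:ℤ)).map_isZero
        (isZero_of_comp_zero (inR H (𝟭 C)) (Comma.fst H (𝟭 C)) (inRfst _ _) Y')).of_iso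
        (((DF (Comma.fst H (𝟭 C))).commShiftIso (1:ℤ)).app _)
  have ab : ∀ Y X', Bij Λ ((DF (inL (𝟭 C) H)).obj Y) ((DF (bR H)).obj X') := by
    intro Y X'
    apply Bij.of_zero
    · intro f
      exact adj_hom_zero_right (dfAdj (bRAdj H)) (isZero_of_comp_zero _ _ (inLsnd _ _) _) f
    · have z : IsZero ((DF (Comma.snd H (𝟭 C))).obj (Λ.obj ((DF (bR H)).obj X'))) := by
        apply lam_zero adj
        have h1 := df_counit_iso (arDAdj (Comma H (𝟭 C))) (bR H ⋙ psi H)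
          (ev1 _ ⋙ Comma.snd H (𝟭 C)) (fun X => by
            show IsIso (((arDAdj (Comma H (𝟭 C))).counit.app ((bR H ⋙ psi H).obj X)).right.right)
            rw [bLAdj_counit_right]
            exact IsIso.id _) X'
        have e := (dfComp (bR H) (psi H)).app X'
        have n := (dfAdj (arDAdj (Comma H (𝟭 C)))).counit.naturality e.hom
        have h2 : IsIso ((DF (ev1 _ ⋙ Comma.snd H (𝟭 C))).map
          ((DF (ev0 _) ⋙ DF (arD (Comma H (𝟭 C)))).map e.hom ≫
            (dfAdj (arDAdj (Comma H (𝟭 C)))).counit.app ((DF (bR H ⋙ psi H)).obj X'))) := by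
          rw [Functor.map_comp]; infer_instance
        rw [n, Functor.map_comp] at h2
        exact @IsIso.of_isIso_comp_right _ _ _ _ _ _ _ _ h2
      have key : ∀ f : ((DF (inR H (𝟭 C))).obj Y)⟦(1:ℤ)⟧ ⟶ Λ.obj ((DF (bR H)).obj X'), f = 0 := by
        apply hom_zero_iso (((DF (inR H (𝟭 C))).commShiftIso (1:ℤ)).app Y) (Iso.refl _)
        intro f
        exact adj_hom_zero_left (dfAdj (inRAdj H (𝟭 C))) z f
      exact hom_zero_iso (lamA Y).some.symm (Iso.refl _) key
  have aall : ∀ Y e', Bij Λ ((DF (inL (𝟭 C) H)).obj Y) e' := by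
    intro Y e'
    obtain ⟨X', Y', f, g, h, ht⟩ := decomp2 H e'
    refine Bij.ext_right Λ _ ht _ ?_ (aa _ _) (ab _ _) ?_
    · exact (ab Y (X'⟦(-1:ℤ)⟧)).iso_right (((DF (bR H)).commShiftIso (-1:ℤ)).app _)
    · exact (aa Y (Y'⟦(1:ℤ)⟧)).iso_right (((DF (inL (𝟭 C) H)).commShiftIso (1:ℤ)).app _)
  have call : ∀ X e', Bij Λ ((DF (inR (𝟭 C) H)).obj X) e' := by
    intro X e'
    obtain ⟨X', Y', f, g, h, ht⟩ := decomp1 H e'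
    refine Bij.ext_right Λ _ ht _ ?_ (cc _ _) (ca _ _) ?_
    · exact (ca X (Y'⟦(-1:ℤ)⟧)).iso_right (((DF (inL (𝟭 C) H)).commShiftIso (-1:ℤ)).app _)
    · exact (cc X (X'⟦(1:ℤ)⟧)).iso_right (((DF (inR (𝟭 C) H)).commShiftIso (1:ℤ)).app _)
  have all : ∀ e e', Bij Λ e e' := by
    intro e e'
    obtain ⟨X, Y, f, g, h, ht⟩ := decomp1 H e
    refine Bij.ext_left Λ _ ht _ ?_ (aall _ _) (call _ _) ?_
    · exact (call (X⟦(1:ℤ)⟧) e').iso_left (((DF (inR (𝟭 C) H)).commShiftIso (1:ℤ)).app _)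
    · exact (aall (Y⟦(-1:ℤ)⟧) e').iso_left (((DF (inL (𝟭 C) H)).commShiftIso (-1:ℤ)).app _)
  obtain ⟨hf, hff⟩ := ff_of_bij Λ all
  have hs : Λ.EssSurj := by
    constructor
    intro e
    obtain ⟨X, Y, f, g, h, ht⟩ := decomp3 H e
    refine Λ.essImage.ext_of_isTriangulatedClosed₂ _ ht ?_ ?_
    · exact ⟨_, ⟨iC.app X⟩⟩
    · obtain ⟨i⟩ := lamA (Y⟦(-1:ℤ)⟧)
      refine ⟨_, ⟨i ≪≫ ((DF (inR H (𝟭 C))).commShiftIso (1:ℤ)).symm.app _ ≪≫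
        (DF (inR H (𝟭 C))).mapIso ((shiftFunctorCompIsoId _ (-1:ℤ) 1 (by simp)).app Y)⟩⟩
  exact ⟨Λ, inferInstance, inferInstance, ⟨hff, hf, hs⟩⟩

end
end NakE7

-- Part 8

namespace NakE7
open Limits MulOpposite

section
variable (k : Type) [Field k] (Q : PreQuiver) (R : Set (List Q.A))

open Classical in
/-- the arrow operator on the total space -/
noncomputable def opA {k : Type} [Field k] {Q : PreQuiver} (V : Q.V → ModuleCat.{0} k)
    (f : ∀ a, V (Q.s a) ⟶ V (Q.t a)) (a : Q.A) : Module.End k (∀ v, V v) :=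
  (LinearMap.single k (fun v => V v) (Q.t a)) ∘ₗ (f a).hom ∘ₗ (LinearMap.proj (Q.s a))

open Classical in
noncomputable def opE {k : Type} [Field k] {Q : PreQuiver} (V : Q.V → ModuleCat.{0} k)
    (v : Q.V) : Module.End k (∀ v, V v) :=
  (LinearMap.single k (fun v => V v) v) ∘ₗ (LinearMap.proj v)

open Classical in
lemma opA_apply {k : Type} [Field k] {Q : PreQuiver} (V : Q.V → ModuleCat.{0} k)
    (f : ∀ a, V (Q.s a) ⟶ V (Q.t a)) (a : Q.A) (x) :
    opA V f a x = Pi.single (Q.t a) ((f a).hom (x (Q.s a))) := rfl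

open Classical in
lemma opE_apply {k : Type} [Field k] {Q : PreQuiver} (V : Q.V → ModuleCat.{0} k)
    (v : Q.V) (x) : opE V v x = Pi.single v (x v) := rfl

/-- representations of a quiver with zero relations -/
structure QRep where
  V : Q.V → ModuleCat.{0} k
  f : ∀ a, V (Q.s a) ⟶ V (Q.t a)
  rel : ∀ p ∈ R, ∀ x : (∀ v, V v), p.foldl (fun x a => opA V f a x) x = 0

variable {k Q R}

def homSub (X Y : QRep k Q R) : AddSubgroup (∀ v, X.V v ⟶ Y.V v) where
  carrier := {g | ∀ a, X.f a ≫ g (Q.t a) = g (Q.s a) ≫ Y.f a}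
  add_mem' := fun {g h} hg hh a => by
    have := hg a; have := hh a
    simp_all [Preadditive.comp_add, Preadditive.add_comp]
  zero_mem' := fun a => by simp
  neg_mem' := fun {g} hg a => by have := hg a; simp_all

instance : Category (QRep k Q R) where
  Hom X Y := homSub X Y
  id X := ⟨fun v => 𝟙 _, fun a => by simp⟩
  comp {X Y Z} f g := ⟨fun v => f.1 v ≫ g.1 v, fun a => by
    have h1 := f.2 a; have h2 := g.2 a
    rw [← Category.assoc, h1, Category.assoc, h2, Category.assoc]⟩
  id_comp f := Subtype.ext (funext fun v => Category.id_comp _)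
  comp_id f := Subtype.ext (funext fun v => Category.comp_id _)
  assoc f g h := Subtype.ext (funext fun v => Category.assoc _ _ _)

/-- component of a morphism -/
def cmp {X Y : QRep k Q R} (f : X ⟶ Y) (v : Q.V) : X.V v ⟶ Y.V v := f.1 v

lemma cmp_comm {X Y : QRep k Q R} (f : X ⟶ Y) (a : Q.A) :
    X.f a ≫ cmp f (Q.t a) = cmp f (Q.s a) ≫ Y.f a := f.2 a

def mkHom {X Y : QRep k Q R} (g : ∀ v, X.V v ⟶ Y.V v)
    (h : ∀ a, X.f a ≫ g (Q.t a) = g (Q.s a) ≫ Y.f a) : X ⟶ Y := ⟨g, h⟩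

lemma cmp_mkHom {X Y : QRep k Q R} (g : ∀ v, X.V v ⟶ Y.V v) (h) (v) :
  cmp (mkHom g h) v = g v := rfl
lemma cmp_id (X : QRep k Q R) (v) : cmp (𝟙 X) v = 𝟙 _ := rfl
lemma cmp_comp {X Y Z : QRep k Q R} (f : X ⟶ Y) (g : Y ⟶ Z) (v) :
  cmp (f ≫ g) v = cmp f v ≫ cmp g v := rfl
lemma hom_ext' {X Y : QRep k Q R} {f g : X ⟶ Y} (h : ∀ v, cmp f v = cmp g v) : f = g :=
  Subtype.ext (funext h)

instance : Preadditive (QRep k Q R) where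
  homGroup X Y := inferInstanceAs (AddCommGroup (homSub X Y))
  add_comp X Y Z f f' g := Subtype.ext (funext fun v => Preadditive.add_comp _ _ _ _ _ _)
  comp_add X Y Z f g g' := Subtype.ext (funext fun v => Preadditive.comp_add _ _ _ _ _ _)

lemma cmp_add {X Y : QRep k Q R} (f g : X ⟶ Y) (v) : cmp (f + g) v = cmp f v + cmp g v := rfl
lemma cmp_zero {X Y : QRep k Q R} (v) : cmp (0 : X ⟶ Y) v = 0 := rfl

/-- iso from components -/
def mkIso {X Y : QRep k Q R} (g : ∀ v, X.V v ≅ Y.V v)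
    (h : ∀ a, X.f a ≫ (g (Q.t a)).hom = (g (Q.s a)).hom ≫ Y.f a) : X ≅ Y where
  hom := mkHom (fun v => (g v).hom) h
  inv := mkHom (fun v => (g v).inv) (fun a => by
    rw [← cancel_epi (g (Q.s a)).hom, ← cancel_mono (g (Q.t a)).hom]
    simp [h])
  hom_inv_id := hom_ext' fun v => (g v).hom_inv_id
  inv_hom_id := hom_ext' fun v => (g v).inv_hom_id

/-- evaluation -/
def evQ (v : Q.V) : QRep k Q R ⥤ ModuleCat.{0} k where
  obj X := X.V v
  map f := cmp f v

instance (v : Q.V) : (evQ (R := R) (k := k) v).Additive := ⟨rfl⟩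

/-! the algebra action -/
abbrev PA (k : Type) [Field k] (Q : PreQuiver) (R : Set (List Q.A)) := PathAlgebraRel k Q R

noncomputable def gE (v : Q.V) : PA k Q R := RingQuot.mkAlgHom k _ (FreeAlgebra.ι k (Sum.inl v))
noncomputable def gA (a : Q.A) : PA k Q R := RingQuot.mkAlgHom k _ (FreeAlgebra.ι k (Sum.inr a))

noncomputable def preAct (X : QRep k Q R) : FreeAlgebra k (Q.V ⊕ Q.A) →ₐ[k] (Module.End k (∀ v, X.V v))ᵐᵒᵖ :=
  FreeAlgebra.lift k (Sum.elim (fun v => op (opE X.V v)) (fun a => op (opA X.V X.f a)))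

lemma prod_foldl (X : QRep k Q R) (p : List Q.A) (x) :
    unop ((p.map fun a => op (opA X.V X.f a)).prod) x = p.foldl (fun x a => opA X.V X.f a x) x := by
  induction p generalizing x with
  | nil => rfl
  | cons a p ih =>
    rw [List.map_cons, List.prod_cons, unop_mul, List.foldl_cons, ← ih]; rfl

open Classical in
noncomputable def act (X : QRep k Q R) : PA k Q R →ₐ[k] (Module.End k (∀ v, X.V v))ᵐᵒᵖ :=
  RingQuot.liftAlgHom k ⟨preAct X, fun x y h => by
    cases h with
    | idem v =>
      simp only [map_mul, preAct, FreeAlgebra.lift_ι_apply, Sum.elim_inl, ← op_mul]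
      congr 1
      apply LinearMap.ext; intro x
      rw [Module.End.mul_apply, opE_apply, opE_apply, Pi.single_eq_same]
    | orth v w h =>
      simp only [map_mul, preAct, FreeAlgebra.lift_ι_apply, Sum.elim_inl, ← op_mul, map_zero]
      rw [← MulOpposite.op_zero]
      congr 1
      apply LinearMap.ext; intro x
      rw [Module.End.mul_apply, opE_apply, opE_apply, Pi.single_eq_of_ne (Ne.symm h), Pi.single_zero]; rfl
    | unit =>
      simp only [map_sum, preAct, FreeAlgebra.lift_ι_apply, Sum.elim_inl, map_one]
      apply unop_injective
      rw [Finset.unop_sum]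
      apply LinearMap.ext; intro x
      rw [LinearMap.sum_apply]
      simp only [unop_op, opE_apply]
      exact Finset.univ_sum_single x
    | source a =>
      simp only [map_mul, preAct, FreeAlgebra.lift_ι_apply, Sum.elim_inl, Sum.elim_inr, ← op_mul]
      congr 1
      apply LinearMap.ext; intro x
      rw [Module.End.mul_apply, opE_apply, opA_apply, opA_apply, Pi.single_eq_same]
    | target a =>
      simp only [map_mul, preAct, FreeAlgebra.lift_ι_apply, Sum.elim_inl, Sum.elim_inr, ← op_mul]
      congr 1
      apply LinearMap.ext; intro x
      rw [Module.End.mul_apply, opE_apply, opA_apply, Pi.single_eq_same]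
    | zeroRel p hp =>
      rw [map_list_prod, map_zero, List.map_map]
      apply unop_injective
      apply LinearMap.ext; intro x
      have h2 : (⇑(preAct X) ∘ fun a => FreeAlgebra.ι k (Sum.inr a)) = fun a => op (opA X.V X.f a) := by
        funext a; simp [preAct]
      rw [h2, prod_foldl, X.rel p hp]; rfl⟩

lemma act_gE (X : QRep k Q R) (v) : act X (gE v) = op (opE X.V v) := by
  simp [act, gE, preAct]
lemma act_gA (X : QRep k Q R) (a) : act X (gA a) = op (opA X.V X.f a) := by
  simp [act, gA, preAct]

/-- total space -/
def Tot (X : QRep k Q R) : Type := ∀ v, X.V v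
noncomputable instance (X : QRep k Q R) : AddCommGroup (Tot X) := inferInstanceAs (AddCommGroup (∀ v, X.V v))
noncomputable instance (X : QRep k Q R) : Module (PA k Q R)ᵐᵒᵖ (Tot X) where
  smul r x := unop (act X (unop r)) x
  one_smul x := by
    show unop (act X (unop 1)) x = x
    simp
    rfl
  mul_smul r s x := by
    show unop (act X (unop (r * s))) x = unop (act X (unop r)) (unop (act X (unop s)) x)
    simp
    rfl
  smul_zero r := map_zero (unop (act X (unop r)))
  smul_add r x y := map_add (unop (act X (unop r))) x y
  add_smul r s x := by
    show unop (act X (unop (r + s))) x = unop (act X (unop r)) x + unop (act X (unop s)) x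
    simp
    rfl
  zero_smul x := by
    show unop (act X (unop 0)) x = 0
    simp
    rfl

lemma smul_def (X : QRep k Q R) (r : (PA k Q R)) (x : Tot X) : op r • x = unop (act X r) x := rfl
open Classical in
lemma smul_gE (X : QRep k Q R) (v) (x : Tot X) :
    (op (gE v : PA k Q R) • x : Tot X) = (Pi.single v (x v) : ∀ v, X.V v) := by
  rw [smul_def, act_gE]; rfl
open Classical in
lemma smul_gA (X : QRep k Q R) (a) (x : Tot X) :
    (op (gA a : PA k Q R) • x : Tot X) = (Pi.single (Q.t a) ((X.f a).hom (x (Q.s a))) : ∀ v, X.V v) := by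
  rw [smul_def, act_gA]; rfl
lemma smul_alg (X : QRep k Q R) (c : k) (x : Tot X) :
    (op (algebraMap k (PA k Q R) c) • x : Tot X) = (c • (show ∀ v, X.V v from x) : ∀ v, X.V v) := by
  rw [smul_def, AlgHom.commutes]; rfl

/-- induction principle for the algebra -/
lemma PA_induction {P : PA k Q R → Prop} (hc : ∀ c, P (algebraMap k _ c)) (hE : ∀ v, P (gE v))
    (hA : ∀ a, P (gA a)) (hm : ∀ x y, P x → P y → P (x * y)) (ha : ∀ x y, P x → P y → P (x + y)) (x) :
    P x := by
  obtain ⟨y, rfl⟩ := RingQuot.mkAlgHom_surjective k (PathAlgRel k Q R) x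
  induction y using FreeAlgebra.induction with
  | grade0 r => rw [AlgHom.commutes]; exact hc r
  | grade1 x => cases x with
    | inl v => exact hE v
    | inr a => exact hA a
  | mul a b h1 h2 => rw [map_mul]; exact hm _ _ h1 h2
  | add a b h1 h2 => rw [map_add]; exact ha _ _ h1 h2

end
end NakE7

-- Part 9

namespace NakE7
open Limits MulOpposite

section
variable {k : Type} [Field k] {Q : PreQuiver} {R : Set (List Q.A)}

def tmap {X Y : QRep k Q R} (g : X ⟶ Y) (x : Tot X) : Tot Y := fun v => (cmp g v).hom (x v)

lemma tmap_smul {X Y : QRep k Q R} (g : X ⟶ Y) (r : PA k Q R) : ∀ (x : Tot X) ,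
    tmap g (op r • x : Tot X) = op r • tmap g x := by
  classical
  induction r using PA_induction with
  | hc c =>
    intro x
    rw [smul_alg, smul_alg]
    funext v
    exact (cmp g v).hom.map_smul c (x v)
  | hE v =>
    intro x
    rw [smul_gE, smul_gE]
    funext w
    show (cmp g w).hom ((Pi.single v (x v) : ∀ v, X.V v) w) = (Pi.single v ((cmp g v).hom (x v)) : ∀ v, Y.V v) w
    by_cases h : w = v
    · subst h; rw [Pi.single_eq_same, Pi.single_eq_same]
    · rw [Pi.single_eq_of_ne h, Pi.single_eq_of_ne h, map_zero]
  | hA a =>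
    intro x
    rw [smul_gA, smul_gA]
    funext w
    show (cmp g w).hom ((Pi.single (Q.t a) ((X.f a).hom (x (Q.s a))) : ∀ v, X.V v) w) =
      (Pi.single (Q.t a) ((Y.f a).hom ((cmp g (Q.s a)).hom (x (Q.s a)))) : ∀ v, Y.V v) w
    by_cases h : w = Q.t a
    · subst h; rw [Pi.single_eq_same, Pi.single_eq_same]
      exact congrArg (fun f => f.hom (x (Q.s a))) (cmp_comm g a)
    · rw [Pi.single_eq_of_ne h, Pi.single_eq_of_ne h, map_zero]
  | hm r s hr hs =>
    intro x
    rw [op_mul, mul_smul, mul_smul, hs, hr]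
  | ha r s hr hs =>
    intro x
    rw [MulOpposite.op_add, add_smul, add_smul, ← hr, ← hs]
    funext v
    exact map_add (cmp g v).hom _ _

/-- from representations to modules -/
noncomputable def TT : QRep k Q R ⥤ ModuleCat.{0} (PA k Q R)ᵐᵒᵖ where
  obj X := ModuleCat.of _ (Tot X)
  map {X Y} g := ModuleCat.ofHom
    { toFun := fun x => (fun v => (cmp g v).hom (x v) : Tot Y)
      map_add' := fun x y => funext fun v => map_add (cmp g v).hom _ _
      map_smul' := fun r x => tmap_smul g r.unop x }

lemma TT_map_apply {X Y : QRep k Q R} (g : X ⟶ Y) (x : Tot X) (v) :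
   ((TT.map g).hom x : Tot Y) v = (cmp g v).hom (x v) := rfl

open Classical in
/-- a single element of the total space -/
noncomputable def sg (X : QRep k Q R) (v : Q.V) (x : X.V v) : Tot X := (Pi.single v x : ∀ v, X.V v)
lemma sg_same (X : QRep k Q R) (v : Q.V) (x : X.V v) : sg X v x v = x := by
  classical
  unfold sg; rw [Pi.single_eq_same]
lemma sg_ne (X : QRep k Q R) (v w : Q.V) (x : X.V v) (h : w ≠ v) : sg X v x w = 0 := by
  classical
  unfold sg; rw [Pi.single_eq_of_ne h]
lemma sgE (X : QRep k Q R) (v) (x : Tot X) : op (gE v : PA k Q R) • x = sg X v (x v) := smul_gE _ _ _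
lemma sgA (X : QRep k Q R) (a) (x : Tot X) : op (gA a : PA k Q R) • x = sg X (Q.t a) ((X.f a).hom (x (Q.s a))) := smul_gA _ _ _
lemma sg_add (X : QRep k Q R) (v) (x y : X.V v) : sg X v (x + y) = sg X v x + sg X v y := by
  classical
  exact Pi.single_add _ _ _
lemma sg_smul (X : QRep k Q R) (v) (c : k) (x : X.V v) : sg X v (c • x) = op (algebraMap k (PA k Q R) c) • sg X v x := by
  classical
  rw [smul_alg]; exact Pi.single_smul _ _ _

instance : (TT (k := k) (Q := Q) (R := R)).Faithful where
  map_injective {X Y} f g h := hom_ext' fun v => by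
    ext x
    have := congrFun (congrArg (fun t => (t.hom (sg X v x) : Tot Y)) h) v
    simp only [TT_map_apply, sg_same] at this
    exact this

instance : (TT (k := k) (Q := Q) (R := R)).Full where
  map_surjective {X Y} f := by
    classical
    let F : Tot X →ₗ[(PA k Q R)ᵐᵒᵖ] Tot Y := f.hom
    have key : ∀ x v, F (sg X v (x v)) = sg Y v (F x v) := fun x v => by
      rw [← sgE, ← sgE, F.map_smul]
    refine ⟨mkHom (fun v => ModuleCat.ofHom
      { toFun := fun x => F (sg X v x) v
        map_add' := fun x y => by rw [sg_add, F.map_add]; rfl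
        map_smul' := fun c x => by
          rw [sg_smul, F.map_smul, smul_alg]; rfl }) ?_, ?_⟩
    · intro a
      ext x
      show F (sg X (Q.t a) ((X.f a).hom x)) (Q.t a) = (Y.f a).hom (F (sg X (Q.s a) x) (Q.s a))
      have := sgA X a (sg X (Q.s a) x)
      rw [sg_same] at this
      rw [← this, F.map_smul, sgA, sg_same]
    · apply ModuleCat.hom_ext
      apply LinearMap.ext
      intro x
      funext v
      exact (congrFun (key x v) v).trans (sg_same _ _ _)

/-- restriction of scalars -/
def MK (M : ModuleCat.{0} (PA k Q R)ᵐᵒᵖ) : Type := M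
instance (M : ModuleCat.{0} (PA k Q R)ᵐᵒᵖ) : AddCommGroup (MK M) := inferInstanceAs (AddCommGroup M)
instance (M : ModuleCat.{0} (PA k Q R)ᵐᵒᵖ) : Module (PA k Q R)ᵐᵒᵖ (MK M) := inferInstanceAs (Module (PA k Q R)ᵐᵒᵖ M)
noncomputable instance (M : ModuleCat.{0} (PA k Q R)ᵐᵒᵖ) : Module k (MK M) := Module.compHom M (algebraMap k (PA k Q R)ᵐᵒᵖ)
lemma MK_smul (M : ModuleCat.{0} (PA k Q R)ᵐᵒᵖ) (c : k) (x : MK M) : c • x = op (algebraMap k (PA k Q R) c) • x := rfl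
instance (M : ModuleCat.{0} (PA k Q R)ᵐᵒᵖ) : SMulCommClass (PA k Q R)ᵐᵒᵖ k (MK M) where
  smul_comm r c x := by
    rw [MK_smul, MK_smul, ← mul_smul, ← mul_smul]
    congr 1
    exact (Algebra.commutes (A := (PA k Q R)ᵐᵒᵖ) c r).symm

lemma gE_idem (v : Q.V) : (gE v : PA k Q R) * gE v = gE v := by
  have := RingQuot.mkAlgHom_rel k (PathAlgRel.idem (k := k) (Q := Q) (R := R) v)
  rwa [map_mul] at this
lemma gE_orth (v w : Q.V) (h : v ≠ w) : (gE v : PA k Q R) * gE w = 0 := by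
  have := RingQuot.mkAlgHom_rel k (PathAlgRel.orth (k := k) (Q := Q) (R := R) v w h)
  rwa [map_mul, map_zero] at this
lemma gE_unit : ∑ v, (gE v : PA k Q R) = 1 := by
  have := RingQuot.mkAlgHom_rel k (PathAlgRel.unit (k := k) (Q := Q) (R := R))
  rwa [map_sum, map_one] at this
lemma gA_src (a : Q.A) : (gE (Q.s a) : PA k Q R) * gA a = gA a := by
  have := RingQuot.mkAlgHom_rel k (PathAlgRel.source (k := k) (Q := Q) (R := R) a)
  rwa [map_mul] at this
lemma gA_tgt (a : Q.A) : gA a * (gE (Q.t a) : PA k Q R) = gA a := by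
  have := RingQuot.mkAlgHom_rel k (PathAlgRel.target (k := k) (Q := Q) (R := R) a)
  rwa [map_mul] at this
lemma gA_rel (p : List Q.A) (hp : p ∈ R) : (p.map fun a => (gA a : PA k Q R)).prod = 0 := by
  have := RingQuot.mkAlgHom_rel k (PathAlgRel.zeroRel (k := k) (Q := Q) (R := R) p hp)
  rwa [map_list_prod, List.map_map, map_zero] at this

/-- image of idempotent -/
noncomputable def VM (M : ModuleCat.{0} (PA k Q R)ᵐᵒᵖ) (v : Q.V) : Submodule k (MK M) where
  carrier := {x | op (gE v : PA k Q R) • x = x}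
  add_mem' := fun {x y} hx hy => by simp_all [smul_add]
  zero_mem' := by simp
  smul_mem' := fun c x hx => by
    have hx' : op (gE v : PA k Q R) • x = x := hx
    show op (gE v : PA k Q R) • (c • x) = c • x
    rw [smul_comm, hx']

noncomputable def FM (M : ModuleCat.{0} (PA k Q R)ᵐᵒᵖ) (a : Q.A) : VM M (Q.s a) →ₗ[k] VM M (Q.t a) where
  toFun x := ⟨op (gA a : PA k Q R) • x.1, by
    show op (gE (Q.t a) : PA k Q R) • (op (gA a : PA k Q R) • x.1) = _
    rw [← mul_smul, ← op_mul, gA_tgt]⟩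
  map_add' x y := Subtype.ext (smul_add _ _ _)
  map_smul' c x := Subtype.ext (smul_comm _ _ _)

noncomputable def sumM (M : ModuleCat.{0} (PA k Q R)ᵐᵒᵖ) (x : ∀ v, VM M v) : MK M := ∑ v, (x v).1

lemma e_sumM (M : ModuleCat.{0} (PA k Q R)ᵐᵒᵖ) (x : ∀ v, VM M v) (v : Q.V) :
    op (gE v : PA k Q R) • sumM M x = (x v).1 := by
  classical
  unfold sumM
  rw [Finset.smul_sum, Finset.sum_eq_single v]
  · exact (x v).2
  · intro w _ h
    have := (x w).2
    have h2 : op (gE w : PA k Q R) • (x w).1 = (x w).1 := this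
    rw [← h2, ← mul_smul, ← op_mul, gE_orth _ _ h, MulOpposite.op_zero, zero_smul]
  · simp

lemma sumM_inj (M : ModuleCat.{0} (PA k Q R)ᵐᵒᵖ) (x y : ∀ v, VM M v) (h : sumM M x = sumM M y) : x = y := by
  funext v
  apply Subtype.ext
  rw [← e_sumM, ← e_sumM, h]

open Classical in
lemma sumM_single (M : ModuleCat.{0} (PA k Q R)ᵐᵒᵖ) (v) (x : VM M v) : sumM M (Pi.single v x) = x.1 := by
  unfold sumM
  rw [Finset.sum_eq_single v]
  · rw [Pi.single_eq_same]
  · intro w _ h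
    rw [Pi.single_eq_of_ne h]; rfl
  · simp

lemma a_sumM (M : ModuleCat.{0} (PA k Q R)ᵐᵒᵖ) (x : ∀ v, VM M v) (a : Q.A) :
    op (gA a : PA k Q R) • sumM M x = sumM M (opA (fun v => ModuleCat.of k (VM M v)) (fun a => ModuleCat.ofHom (FM M a)) a x) := by
  classical
  rw [opA_apply]
  erw [sumM_single M (Q.t a)]
  show _ = op (gA a : PA k Q R) • (x (Q.s a)).1
  rw [← e_sumM, ← mul_smul, ← op_mul, gA_src]

lemma fold_sumM (M : ModuleCat.{0} (PA k Q R)ᵐᵒᵖ) (p : List Q.A) : ∀ (x : ∀ v, VM M v) ,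
    sumM M (p.foldl (fun x a => opA (fun v => ModuleCat.of k (VM M v)) (fun a => ModuleCat.ofHom (FM M a)) a x) x) = 
    op ((p.map fun a => (gA a : PA k Q R)).prod) • sumM M x := by
  induction p with
  | nil => intro x; simp
  | cons a p ih => 
    intro x
    rw [List.foldl_cons, List.map_cons, List.prod_cons, op_mul, mul_smul, a_sumM]
    exact ih _

noncomputable def preT (M : ModuleCat.{0} (PA k Q R)ᵐᵒᵖ) : QRep k Q R where
  V v := ModuleCat.of k (VM M v)
  f a := ModuleCat.ofHom (FM M a)
  rel p hp x := by
    apply sumM_inj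
    rw [fold_sumM, gA_rel p hp, MulOpposite.op_zero, zero_smul]
    exact (Finset.sum_eq_zero fun _ _ => rfl).symm

lemma sumM_smul (M : ModuleCat.{0} (PA k Q R)ᵐᵒᵖ) (r : PA k Q R) : ∀ (x : Tot (preT M)),
    sumM M (op r • x : Tot (preT M)) = op r • sumM M x := by
  classical
  induction r using PA_induction with
  | hc c =>
    intro x
    rw [smul_alg, ← MK_smul]
    unfold sumM
    rw [Finset.smul_sum]
    rfl
  | hE v =>
    intro x
    refine Eq.trans ?_ (e_sumM M x v).symm
    rw [smul_gE]
    exact sumM_single M v _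
  | hA a =>
    intro x
    rw [smul_def, act_gA]
    exact (a_sumM M x a).symm
  | hm r s hr hs =>
    intro x
    rw [op_mul, mul_smul, mul_smul, hs, hr]
  | ha r s hr hs =>
    intro x
    rw [MulOpposite.op_add, add_smul, add_smul, ← hr, ← hs]
    exact Finset.sum_add_distrib

instance : (TT (k := k) (Q := Q) (R := R)).EssSurj where
  mem_essImage M := by
    let F : Tot (preT M) →ₗ[(PA k Q R)ᵐᵒᵖ] M :=
      { toFun := sumM M
        map_add' := fun x y => Finset.sum_add_distrib
        map_smul' := fun r x => sumM_smul M r.unop x }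
    have hF : Function.Bijective F := by
      refine ⟨fun x y h => sumM_inj M x y h, fun m => ?_⟩
      refine ⟨(fun v => ⟨op (gE v : PA k Q R) • (m : MK M), ?_⟩ : ∀ v, VM M v), ?_⟩
      · show op (gE v : PA k Q R) • (op (gE v : PA k Q R) • (m : MK M)) = _
        rw [← mul_smul, ← op_mul, gE_idem]
      · show ∑ v, op (gE v : PA k Q R) • (m : MK M) = m
        rw [← Finset.sum_smul, ← Finset.op_sum, gE_unit, op_one, one_smul]
    exact ⟨preT M, ⟨(LinearEquiv.ofBijective F hF).toModuleIso⟩⟩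

instance : (TT (k := k) (Q := Q) (R := R)).IsEquivalence where

instance : (TT (k := k) (Q := Q) (R := R)).Additive := ⟨fun {X Y f g} => by
  apply ModuleCat.hom_ext; apply LinearMap.ext; intro x; rfl⟩

end
end NakE7

-- Part 10

namespace NakE7
open Limits MulOpposite

section
variable {k : Type} [Field k] {Q : PreQuiver} {R : Set (List Q.A)}

noncomputable instance : Abelian (QRep k Q R) := by
  haveI : HasFiniteProducts (QRep k Q R) := ⟨fun n =>
    Adjunction.hasLimitsOfShape_of_equivalence (TT (k := k) (Q := Q) (R := R))⟩
  exact abelianOfEquivalence (TT (k := k) (Q := Q) (R := R))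

lemma exact_iff (S : ShortComplex (QRep k Q R)) : S.Exact ↔ ∀ v, (S.map (evQ v)).Exact := by
  rw [← ShortComplex.exact_map_iff_of_faithful S TT, ShortComplex.moduleCat_exact_iff]
  have e : (∀ v, (S.map (evQ v)).Exact) ↔ ∀ v, ∀ x : S.X₂.V v, (cmp S.g v).hom x = 0 → ∃ y : S.X₁.V v, (cmp S.f v).hom y = x :=
    forall_congr' fun v => ShortComplex.moduleCat_exact_iff _
  rw [e]
  have e2 : (∀ x : Tot S.X₂, (∀ v, (cmp S.g v).hom (x v) = 0) → ∃ y : Tot S.X₁, ∀ v, (cmp S.f v).hom (y v) = x v) ↔ ∀ v, ∀ x : S.X₂.V v, (cmp S.g v).hom x = 0 → ∃ y : S.X₁.V v, (cmp S.f v).hom y = x := by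
    constructor
    · intro h v x hx
      obtain ⟨y, hy⟩ := h (sg _ v x) (fun w => by
        by_cases hw : w = v
        · subst hw; rw [sg_same, hx]
        · rw [sg_ne _ _ _ _ hw, map_zero])
      exact ⟨y v, by rw [hy, sg_same]⟩
    · intro h x hx
      choose y hy using fun v => h v (x v) (hx v)
      exact ⟨y, hy⟩
  rw [← e2]
  refine forall_congr' fun x => ?_
  constructor
  · intro h hx
    obtain ⟨y, hy⟩ := h (funext hx)
    exact ⟨y, fun v => congrFun hy v⟩
  · intro h hx
    obtain ⟨y, hy⟩ := h (fun v => congrFun hx v)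
    exact ⟨y, funext hy⟩

universe u₁ v₁ u₂ v₂

lemma ex_of_exact {A : Type u₁} [Category.{v₁} A] [Abelian A] {B : Type u₂} [Category.{v₂} B] [Abelian B]
    (F : A ⥤ B) [F.Additive] (h : ∀ S : ShortComplex A, S.Exact → (S.map F).Exact) : Ex F := by
  have := ((Functor.exact_tfae F).out 1 3).1 h
  exact ⟨inferInstance, this.1, this.2⟩

lemma ex_exact {A : Type u₁} [Category.{v₁} A] [Abelian A] {B : Type u₂} [Category.{v₂} B] [Abelian B]
    (F : A ⥤ B) [Ex F] (S : ShortComplex A) (hS : S.Exact) : (S.map F).Exact := hS.map F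

instance exEv (v : Q.V) : Ex (evQ (k := k) (R := R) v) :=
  ex_of_exact _ fun S hS => (exact_iff S).1 hS v

lemma ex_ev {A : Type u₁} [Category.{v₁} A] [Abelian A] (G : A ⥤ QRep k Q R)
    (h : ∀ v, Ex (G ⋙ evQ v)) : Ex G := by
  haveI : G.Additive := ⟨fun {X Y f g} => hom_ext' fun v =>
    (h v).add.map_add (f := f) (g := g)⟩
  refine ex_of_exact _ fun S hS => (exact_iff _).2 fun v => ?_
  haveI := h v
  exact ex_exact (G ⋙ evQ v) S hS

/-- path algebra modules and representations -/
lemma te_TT : TE (QRep k Q R) (ModuleCat.{0} (PA k Q R)ᵐᵒᵖ) := TE.of_equiv (TT (k := k) (Q := Q) (R := R)).asEquivalence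

lemma de_of_te {Q' : PreQuiver} {R' : Set (List Q'.A)} (h : TE (QRep k Q R) (QRep k Q' R')) :
    DerivedEquivalent k (PA k Q R) (PA k Q' R') :=
  (te_TT.symm.trans h).trans te_TT

lemma te_of_functor {A : Type u₁} [Category.{v₁} A] [Abelian A]
    (G : A ⥤ QRep k Q R) [G.Full] [G.Faithful] [G.EssSurj] : TE A (QRep k Q R) := by
  haveI : G.IsEquivalence := {}
  exact TE.of_equiv G.asEquivalence
end
end NakE7

-- Part 11

namespace NakE7
open Limits MulOpposite

section
variable (k : Type) [Field k]

/-- isomorphism of quivers with relations -/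
structure QI (Q : PreQuiver) (R : Set (List Q.A)) (Q' : PreQuiver) (R' : Set (List Q'.A)) where
  eV : Q.V ≃ Q'.V
  eA : Q.A ≃ Q'.A
  hs : ∀ a, Q'.s (eA a) = eV (Q.s a)
  ht : ∀ a, Q'.t (eA a) = eV (Q.t a)
  hR : ∀ p, p ∈ R ↔ p.map eA ∈ R'

variable {Q : PreQuiver} {R : Set (List Q.A)} {Q' : PreQuiver} {R' : Set (List Q'.A)}

def QI.symm (e : QI Q R Q' R') : QI Q' R' Q R where
  eV := e.eV.symm
  eA := e.eA.symm
  hs a := by rw [Equiv.eq_symm_apply, ← e.hs, Equiv.apply_symm_apply]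
  ht a := by rw [Equiv.eq_symm_apply, ← e.ht, Equiv.apply_symm_apply]
  hR p := by rw [e.hR, List.map_map]; simp

noncomputable def QI.hom (e : QI Q R Q' R') : PA k Q R →ₐ[k] PA k Q' R' :=
  RingQuot.liftAlgHom k ⟨FreeAlgebra.lift k (Sum.elim (fun v => gE (e.eV v)) (fun a => gA (e.eA a))), fun x y h => by
    cases h with
    | idem v => simp [gE_idem]
    | orth v w h => simpa using gE_orth _ _ (fun h' => h (e.eV.injective h'))
    | unit =>
      simp only [map_sum, FreeAlgebra.lift_ι_apply, Sum.elim_inl, map_one]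
      rw [← gE_unit]
      exact Equiv.sum_comp e.eV (fun v => (gE v : PA k Q' R'))
    | source a => simp [← e.hs, gA_src]
    | target a => simp [← e.ht, gA_tgt]
    | zeroRel p hp =>
      rw [map_list_prod, map_zero, List.map_map, ← gA_rel (p.map e.eA) ((e.hR p).1 hp), List.map_map]
      congr 1
      apply List.map_congr_left
      intro a _
      simp⟩

lemma QI.hom_gE (e : QI Q R Q' R') (v) : e.hom k (gE v) = gE (e.eV v) := by
  simp [QI.hom, gE]
lemma QI.hom_gA (e : QI Q R Q' R') (a) : e.hom k (gA a) = gA (e.eA a) := by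
  simp [QI.hom, gA]

lemma QI.hom_hom (e : QI Q R Q' R') (x) : e.symm.hom k (e.hom k x) = x := by
  induction x using PA_induction with
  | hc c => rw [AlgHom.commutes, AlgHom.commutes]
  | hE v => rw [QI.hom_gE, QI.hom_gE]; simp [QI.symm]
  | hA a => rw [QI.hom_gA, QI.hom_gA]; simp [QI.symm]
  | hm x y hx hy => rw [map_mul, map_mul, hx, hy]
  | ha x y hx hy => rw [map_add, map_add, hx, hy]

noncomputable def QI.ringEquiv (e : QI Q R Q' R') : PA k Q R ≃+* PA k Q' R' where
  __ := (e.hom k).toRingHom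
  invFun := e.symm.hom k
  left_inv := e.hom_hom k
  right_inv := e.symm.hom_hom k

lemma QI.te (e : QI Q R Q' R') : TE (QRep k Q R) (QRep k Q' R') :=
  te_TT.trans (((TE.of_equiv (ModuleCat.restrictScalarsEquivalenceOfRingEquiv (e.ringEquiv k).op)).symm).trans te_TT.symm)

end
end NakE7

-- Part 12

namespace NakE7
open Limits MulOpposite

section
variable (k : Type) [Field k] (Q : PreQuiver) (I : Type) [Fintype I] (τ : I → Q.V)

/-- add a source -/
def OutQ : PreQuiver where
  V := Q.V ⊕ Unit
  A := Q.A ⊕ I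
  s := Sum.elim (fun a => Sum.inl (Q.s a)) (fun _ => Sum.inr ())
  t := Sum.elim (fun a => Sum.inl (Q.t a)) (fun i => Sum.inl (τ i))

/-- add a sink -/
def InQ : PreQuiver where
  V := Q.V ⊕ Unit
  A := Q.A ⊕ I
  s := Sum.elim (fun a => Sum.inl (Q.s a)) (fun i => Sum.inl (τ i))
  t := Sum.elim (fun a => Sum.inl (Q.t a)) (fun _ => Sum.inr ())

/-- product of the values -/
def HP : QRep k Q ∅ ⥤ ModuleCat.{0} k where
  obj X := ModuleCat.of k (∀ i, X.V (τ i))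
  map f := ModuleCat.ofHom (LinearMap.pi fun i => (cmp f (τ i)).hom ∘ₗ LinearMap.proj i)

instance : (HP k Q I τ).Additive := ⟨fun {X Y f g} => by
  apply ModuleCat.hom_ext; apply LinearMap.ext; intro x; rfl⟩

instance : Ex (HP k Q I τ) := ex_of_exact _ fun S hS => by
  rw [exact_iff] at hS
  rw [ShortComplex.moduleCat_exact_iff]
  have e : ∀ v, ∀ x : S.X₂.V v, (cmp S.g v).hom x = 0 → ∃ y : S.X₁.V v, (cmp S.f v).hom y = x :=
    fun v => (ShortComplex.moduleCat_exact_iff _).1 (hS v)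
  intro x hx
  choose y hy using fun i => e (τ i) (x i) (congrFun hx i)
  exact ⟨y, funext hy⟩

variable {k Q I τ}

def prj (X : QRep k Q ∅) (i : I) : (HP k Q I τ).obj X ⟶ X.V (τ i) := ModuleCat.ofHom (LinearMap.proj i)

lemma prj_nat {X Y : QRep k Q ∅} (f : X ⟶ Y) (i : I) : (HP k Q I τ).map f ≫ prj Y i = prj X i ≫ cmp f (τ i) := rfl
lemma prj_ext (X : QRep k Q ∅) {W : ModuleCat.{0} k} (f g : W ⟶ (HP k Q I τ).obj X) (h : ∀ i, f ≫ prj X i = g ≫ prj X i) : f = g := by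
  ext x
  funext i
  exact congrArg (fun t => t.hom x) (h i)

open Classical in
noncomputable def inj (X : QRep k Q ∅) (i : I) : X.V (τ i) ⟶ (HP k Q I τ).obj X := ModuleCat.ofHom (LinearMap.single k (fun i => X.V (τ i)) i)

lemma inj_nat {X Y : QRep k Q ∅} (f : X ⟶ Y) (i : I) : inj X i ≫ (HP k Q I τ).map f = cmp f (τ i) ≫ inj Y i := by
  classical
  ext x
  funext j
  show (cmp f (τ j)).hom ((Pi.single i x : ∀ i, X.V (τ i)) j) = (Pi.single i ((cmp f (τ i)).hom x) : ∀ i, Y.V (τ i)) j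
  by_cases h : j = i
  · subst h; rw [Pi.single_eq_same, Pi.single_eq_same]
  · rw [Pi.single_eq_of_ne h, Pi.single_eq_of_ne h, map_zero]
lemma inj_ext (X : QRep k Q ∅) {W : ModuleCat.{0} k} (f g : (HP k Q I τ).obj X ⟶ W) (h : ∀ i, inj X i ≫ f = inj X i ≫ g) : f = g := by
  classical
  ext x
  have e : x = ∑ i, (Pi.single i ((x : ∀ i, X.V (τ i)) i) : ∀ i, X.V (τ i)) := (Finset.univ_sum_single (x : ∀ i, X.V (τ i))).symm
  rw [e]
  erw [map_sum, map_sum]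
  exact Finset.sum_congr rfl fun i _ => congrArg (fun t => t.hom ((x : ∀ i, X.V (τ i)) i)) (h i)

noncomputable def outF : Comma (𝟭 (ModuleCat.{0} k)) (HP k Q I τ) ⥤ QRep k (OutQ Q I τ) ∅ where
  obj c := 
    { V := fun v => match v with
        | Sum.inl v => c.right.V v
        | Sum.inr _ => c.left
      f := fun a => match a with
        | Sum.inl a => c.right.f a
        | Sum.inr i => c.hom ≫ prj c.right i
      rel := fun p hp => hp.elim }
  map {c d} g := mkHom (fun v => match v with
        | Sum.inl v => cmp g.right v
        | Sum.inr _ => g.left) (fun a => match a with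
        | Sum.inl a => cmp_comm g.right a
        | Sum.inr i => by
          have h1 := g.w
          show (c.hom ≫ prj c.right i) ≫ cmp g.right (τ i) = g.left ≫ d.hom ≫ prj d.right i
          rw [Category.assoc, ← prj_nat, ← Category.assoc, ← Category.assoc]
          congr 1
          exact h1.symm)
  map_id c := hom_ext' fun v => match v with
        | Sum.inl v => rfl
        | Sum.inr _ => rfl
  map_comp f g := hom_ext' fun v => match v with
        | Sum.inl v => rfl
        | Sum.inr _ => rfl

instance : (outF (k := k) (Q := Q) (I := I) (τ := τ)).Faithful where
  map_injective {X Y f g} h := by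
    apply Comma.hom_ext
    · exact congrArg (fun t => cmp t (Sum.inr ())) h
    · exact hom_ext' fun v => congrArg (fun t => cmp t (Sum.inl v)) h

instance : (outF (k := k) (Q := Q) (I := I) (τ := τ)).Full where
  map_surjective {X Y} f := by
    refine ⟨{ left := cmp f (Sum.inr ()), right := mkHom (fun v => cmp f (Sum.inl v)) (fun a => cmp_comm f (Sum.inl a)), w := ?_ }, ?_⟩
    · apply prj_ext
      intro i
      have := cmp_comm f (Sum.inr i)
      exact this.symm
    · exact hom_ext' fun v => match v with
        | Sum.inl v => rfl
        | Sum.inr _ => rfl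

instance : (outF (k := k) (Q := Q) (I := I) (τ := τ)).EssSurj where
  mem_essImage Y := by
    refine ⟨{ left := Y.V (Sum.inr ()), right := ⟨fun v => Y.V (Sum.inl v), fun a => Y.f (Sum.inl a), fun p hp => hp.elim⟩, hom := ModuleCat.ofHom (LinearMap.pi fun i => (Y.f (Sum.inr i)).hom) }, ⟨mkIso (fun v => match v with
        | Sum.inl v => Iso.refl _
        | Sum.inr _ => Iso.refl _) (fun a => match a with
        | Sum.inl a => rfl
        | Sum.inr _ => rfl)⟩⟩

noncomputable def inF : Comma (HP k Q I τ) (𝟭 (ModuleCat.{0} k)) ⥤ QRep k (InQ Q I τ) ∅ where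
  obj c := 
    { V := fun v => match v with
        | Sum.inl v => c.left.V v
        | Sum.inr _ => c.right
      f := fun a => match a with
        | Sum.inl a => c.left.f a
        | Sum.inr i => inj c.left i ≫ c.hom
      rel := fun p hp => hp.elim }
  map {c d} g := mkHom (fun v => match v with
        | Sum.inl v => cmp g.left v
        | Sum.inr _ => g.right) (fun a => match a with
        | Sum.inl a => cmp_comm g.left a
        | Sum.inr i => by
          have h1 : (HP k Q I τ).map g.left ≫ d.hom = c.hom ≫ g.right := g.w
          show (inj c.left i ≫ c.hom) ≫ g.right = cmp g.left (τ i) ≫ inj d.left i ≫ d.hom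
          rw [Category.assoc, ← Category.assoc (cmp _ _), ← inj_nat, Category.assoc, h1])
  map_id c := hom_ext' fun v => match v with
        | Sum.inl v => rfl
        | Sum.inr _ => rfl
  map_comp f g := hom_ext' fun v => match v with
        | Sum.inl v => rfl
        | Sum.inr _ => rfl

instance : (inF (k := k) (Q := Q) (I := I) (τ := τ)).Faithful where
  map_injective {X Y f g} h := by
    apply Comma.hom_ext
    · exact hom_ext' fun v => congrArg (fun t => cmp t (Sum.inl v)) h
    · exact congrArg (fun t => cmp t (Sum.inr ())) h

instance : (inF (k := k) (Q := Q) (I := I) (τ := τ)).Full where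
  map_surjective {X Y} f := by
    refine ⟨{ right := cmp f (Sum.inr ()), left := mkHom (fun v => cmp f (Sum.inl v)) (fun a => cmp_comm f (Sum.inl a)), w := ?_ }, ?_⟩
    · apply inj_ext
      intro i
      have h : (inj X.left i ≫ X.hom) ≫ cmp f (Sum.inr ()) = cmp f (Sum.inl (τ i)) ≫ inj Y.left i ≫ Y.hom := cmp_comm f (Sum.inr i)
      rw [← Category.assoc, inj_nat, Category.assoc]
      exact h.symm
    · exact hom_ext' fun v => match v with
        | Sum.inl v => rfl
        | Sum.inr _ => rfl

instance : (inF (k := k) (Q := Q) (I := I) (τ := τ)).EssSurj where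
  mem_essImage Y := by
    refine ⟨{ right := Y.V (Sum.inr ()), left := ⟨fun v => Y.V (Sum.inl v), fun a => Y.f (Sum.inl a), fun p hp => hp.elim⟩, hom := ModuleCat.ofHom (∑ i, (Y.f (Sum.inr i)).hom ∘ₗ LinearMap.proj i) }, ⟨mkIso (fun v => match v with
        | Sum.inl v => Iso.refl _
        | Sum.inr _ => Iso.refl _) (fun a => match a with
        | Sum.inl a => rfl
        | Sum.inr i => ?_)⟩⟩
    classical
    refine ModuleCat.hom_ext (LinearMap.ext fun x => ?_)
    show (∑ j : I, (Y.f (Sum.inr j)).hom ∘ₗ LinearMap.proj j : (∀ j, Y.V (Sum.inl (τ j))) →ₗ[k] Y.V (Sum.inr ())) (Pi.single i x) = (Y.f (Sum.inr i)).hom x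
    rw [LinearMap.sum_apply, Finset.sum_eq_single i]
    · exact congrArg (Y.f (Sum.inr i)).hom (Pi.single_eq_same (M := fun j => Y.V (Sum.inl (τ j))) i x)
    · intro j _ h
      exact (congrArg (Y.f (Sum.inr j)).hom (Pi.single_eq_of_ne (M := fun j => Y.V (Sum.inl (τ j))) h x)).trans (map_zero _)
    · simp

/-- BGP reflection -/
lemma reflection (k : Type) [Field k] (Q : PreQuiver) (I : Type) [Fintype I] (τ : I → Q.V) :
    TE (QRep k (OutQ Q I τ) ∅) (QRep k (InQ Q I τ) ∅) :=
  ((te_of_functor outF).symm.trans (lemmaR (HP k Q I τ))).trans (te_of_functor inF)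

end
end NakE7

-- Part 13

namespace NakE7
open Limits MulOpposite

section
variable (k : Type) [Field k] (QD : PreQuiver) (u : QD.V) (m : ℕ) (QT : PreQuiver) (w : QT.V)

/-- chain glued to `QT` -/
def QC : PreQuiver where
  V := Fin (m+1) ⊕ QT.V
  A := Fin m ⊕ (Unit ⊕ QT.A)
  s := Sum.elim (fun a => Sum.inl a.castSucc) (Sum.elim (fun _ => Sum.inl (Fin.last m)) (fun a => Sum.inr (QT.s a)))
  t := Sum.elim (fun a => Sum.inl a.succ) (Sum.elim (fun _ => Sum.inr w) (fun a => Sum.inr (QT.t a)))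

def NakQ : PreQuiver where
  V := QD.V ⊕ (QC m QT w).V
  A := QD.A ⊕ ((QC m QT w).A ⊕ Unit)
  s := Sum.elim (fun a => Sum.inl (QD.s a)) (Sum.elim (fun a => Sum.inr ((QC m QT w).s a)) (fun _ => Sum.inl u))
  t := Sum.elim (fun a => Sum.inl (QD.t a)) (Sum.elim (fun a => Sum.inr ((QC m QT w).t a)) (fun _ => Sum.inr (Sum.inl 0)))

def StarQ : PreQuiver where
  V := QD.V ⊕ (QC m QT w).V
  A := QD.A ⊕ ((QC m QT w).A ⊕ Unit)
  s := Sum.elim (fun a => Sum.inl (QD.s a)) (Sum.elim (fun a => Sum.inr ((QC m QT w).s a)) (fun _ => Sum.inr (Sum.inl (Fin.last m))))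
  t := Sum.elim (fun a => Sum.inl (QD.t a)) (Sum.elim (fun a => Sum.inr ((QC m QT w).t a)) (fun _ => Sum.inl u))

def nU : (NakQ QD u m QT w).V := Sum.inl u
def nC (j : Fin (m+1)) : (NakQ QD u m QT w).V := Sum.inr (Sum.inl j)
def nW : (NakQ QD u m QT w).V := Sum.inr (Sum.inr w)
def aX : (NakQ QD u m QT w).A := Sum.inr (Sum.inr ())
def aC (j : Fin m) : (NakQ QD u m QT w).A := Sum.inr (Sum.inl (Sum.inl j))
def aW : (NakQ QD u m QT w).A := Sum.inr (Sum.inl (Sum.inr (Sum.inl ())))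

/-- initial part of the relation -/
def preP (j : Fin (m+1)) : List (NakQ QD u m QT w).A :=
  Fin.induction (motive := fun _ => List (NakQ QD u m QT w).A) [aX QD u m QT w]
    (fun a l => l ++ [aC QD u m QT w a]) j

def relP : List (NakQ QD u m QT w).A := preP QD u m QT w (Fin.last m) ++ [aW QD u m QT w]

/-- zero module -/
def Z0 : ModuleCat.{0} k := ModuleCat.of k PUnit

lemma Z0_to {W : ModuleCat.{0} k} (f g : W ⟶ Z0 k) : f = g := by
  apply ModuleCat.hom_ext; apply LinearMap.ext; intro x; rfl
lemma Z0_from {W : ModuleCat.{0} k} (f g : Z0 k ⟶ W) : f = g := by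
  apply ModuleCat.hom_ext; apply LinearMap.ext; intro x
  have : x = 0 := rfl
  rw [this, map_zero, map_zero]

def HC : QRep k QD ∅ ⥤ QRep k (QC m QT w) ∅ where
  obj X :=
    { V := fun v => match v with
        | Sum.inl _ => X.V u
        | Sum.inr _ => Z0 k
      f := fun a => match a with
        | Sum.inl _ => 𝟙 (X.V u)
        | Sum.inr (Sum.inl _) => 0
        | Sum.inr (Sum.inr _) => 0
      rel := fun p hp => hp.elim }
  map {X Y} f := mkHom (fun v => match v with
        | Sum.inl _ => cmp f u
        | Sum.inr _ => 𝟙 _) (fun a => match a with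
        | Sum.inl _ => (Category.id_comp _).trans (Category.comp_id _).symm
        | Sum.inr (Sum.inl _) => Z0_to k _ _
        | Sum.inr (Sum.inr _) => Z0_to k _ _)
  map_id c := hom_ext' fun v => match v with
        | Sum.inl v => rfl
        | Sum.inr _ => rfl
  map_comp f g := hom_ext' fun v => match v with
        | Sum.inl v => rfl
        | Sum.inr _ => rfl

instance exHC : Ex (HC k QD u m QT w) := ex_ev _ fun v => match v with
  | Sum.inl _ => exEv (k := k) (Q := QD) (R := ∅) u
  | Sum.inr _ => Ex.of_zero _ fun X => by
      rw [IsZero.iff_id_eq_zero]; exact Z0_to k _ _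

/-! Star side -/
variable {k QD u m QT w}

noncomputable def starF : Comma (𝟭 (QRep k (QC m QT w) ∅)) (HC k QD u m QT w) ⥤ QRep k (StarQ QD u m QT w) ∅ where
  obj c := 
    { V := fun v => match v with
        | Sum.inl v => c.right.V v
        | Sum.inr v => c.left.V v
      f := fun a => match a with
        | Sum.inl a => c.right.f a
        | Sum.inr (Sum.inl a) => c.left.f a
        | Sum.inr (Sum.inr _) => cmp c.hom (Sum.inl (Fin.last m))
      rel := fun p hp => hp.elim }
  map {c d} g := mkHom (fun v => match v with
        | Sum.inl v => cmp g.right v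
        | Sum.inr v => cmp g.left v) (fun a => match a with
        | Sum.inl a => cmp_comm g.right a
        | Sum.inr (Sum.inl a) => cmp_comm g.left a
        | Sum.inr (Sum.inr _) => (congrArg (fun t => cmp t (Sum.inl (Fin.last m))) g.w).symm)
  map_id c := hom_ext' fun v => match v with
        | Sum.inl v => rfl
        | Sum.inr _ => rfl
  map_comp f g := hom_ext' fun v => match v with
        | Sum.inl v => rfl
        | Sum.inr _ => rfl

instance : (starF (k := k) (QD := QD) (u := u) (m := m) (QT := QT) (w := w)).Faithful where
  map_injective {X Y f g} h := by
    apply Comma.hom_ext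
    · exact hom_ext' fun v => congrArg (fun t => cmp t (Sum.inr v)) h
    · exact hom_ext' fun v => congrArg (fun t => cmp t (Sum.inl v)) h

lemma hc_ext_star {Y : QRep k (QC m QT w) ∅} {X : QRep k QD ∅} (f g : Y ⟶ (HC k QD u m QT w).obj X)
    (h : cmp f (Sum.inl (Fin.last m)) = cmp g (Sum.inl (Fin.last m))) : f = g := by
  refine hom_ext' fun v => ?_
  match v with
  | Sum.inr v => exact Z0_to k _ _
  | Sum.inl j =>
    induction j using Fin.reverseInduction with
    | last => exact h
    | cast j ih =>
      have h1 : Y.f (Sum.inl j) ≫ cmp f (Sum.inl j.succ) = cmp f (Sum.inl j.castSucc) := 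
        (cmp_comm f (Sum.inl j)).trans (Category.comp_id _)
      have h2 : Y.f (Sum.inl j) ≫ cmp g (Sum.inl j.succ) = cmp g (Sum.inl j.castSucc) := 
        (cmp_comm g (Sum.inl j)).trans (Category.comp_id _)
      rw [← h1, ← h2, ih]

instance : (starF (k := k) (QD := QD) (u := u) (m := m) (QT := QT) (w := w)).Full where
  map_surjective {X Y} f := by
    refine ⟨{ left := mkHom (fun v => cmp f (Sum.inr v)) (fun a => cmp_comm f (Sum.inr (Sum.inl a))), right := mkHom (fun v => cmp f (Sum.inl v)) (fun a => cmp_comm f (Sum.inl a)), w := ?_ }, ?_⟩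
    · apply hc_ext_star
      exact (cmp_comm f (Sum.inr (Sum.inr ()))).symm
    · exact hom_ext' fun v => match v with
        | Sum.inl v => rfl
        | Sum.inr _ => rfl

/-- composites to the end of the chain -/
noncomputable def psiCh (Y : QRep k (QC m QT w) ∅) (W : ModuleCat.{0} k) (g : Y.V (Sum.inl (Fin.last m)) ⟶ W) (j : Fin (m+1)) :
    Y.V (Sum.inl j) ⟶ W :=
  Fin.reverseInduction (motive := fun j => Y.V (Sum.inl j) ⟶ W) g (fun j h => Y.f (Sum.inl j) ≫ h) j

lemma psiCh_last (Y : QRep k (QC m QT w) ∅) (W : ModuleCat.{0} k) (g : Y.V (Sum.inl (Fin.last m)) ⟶ W) :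
   psiCh Y W g (Fin.last m) = g := by unfold psiCh; rw [Fin.reverseInduction_last]
lemma psiCh_cast (Y : QRep k (QC m QT w) ∅) (W : ModuleCat.{0} k) (g : Y.V (Sum.inl (Fin.last m)) ⟶ W) (j : Fin m) :
   psiCh Y W g j.castSucc = Y.f (Sum.inl j) ≫ psiCh Y W g j.succ := by exact Fin.reverseInduction_castSucc (motive := fun j => Y.V (Sum.inl j) ⟶ W) (zero := g) (succ := fun j h => Y.f (Sum.inl j) ≫ h) j

instance : (starF (k := k) (QD := QD) (u := u) (m := m) (QT := QT) (w := w)).EssSurj where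
  mem_essImage Y := by
    let Y1 : QRep k (QC m QT w) ∅ := ⟨fun v => Y.V (Sum.inr v), fun a => Y.f (Sum.inr (Sum.inl a)), fun p hp => hp.elim⟩
    let X1 : QRep k QD ∅ := ⟨fun v => Y.V (Sum.inl v), fun a => Y.f (Sum.inl a), fun p hp => hp.elim⟩
    let g : Y1.V (Sum.inl (Fin.last m)) ⟶ X1.V u := Y.f (Sum.inr (Sum.inr ()))
    let h : Y1 ⟶ (HC k QD u m QT w).obj X1 := mkHom (fun v => match v with
        | Sum.inl j => psiCh Y1 _ g j
        | Sum.inr _ => 0) (fun a => match a with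
        | Sum.inl j => (psiCh_cast Y1 _ g j).symm.trans (Category.comp_id _).symm
        | Sum.inr (Sum.inl _) => Z0_to k _ _
        | Sum.inr (Sum.inr _) => Z0_to k _ _)
    refine ⟨{ left := Y1, right := X1, hom := h}, ⟨mkIso (fun v => match v with
        | Sum.inl v => Iso.refl _
        | Sum.inr _ => Iso.refl _) (fun a => match a with
        | Sum.inl a => rfl
        | Sum.inr (Sum.inl _) => rfl
        | Sum.inr (Sum.inr _) => ?_)⟩⟩
    exact (Category.comp_id _).trans ((psiCh_last Y1 _ g).trans (Category.id_comp _).symm)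

/-! Nakayama side -/

lemma hc_ext_nak {Y : QRep k (QC m QT w) ∅} {X : QRep k QD ∅} (f g : (HC k QD u m QT w).obj X ⟶ Y)
    (h : cmp f (Sum.inl 0) = cmp g (Sum.inl 0)) : f = g := by
  refine hom_ext' fun v => ?_
  match v with
  | Sum.inr v => exact Z0_from k _ _
  | Sum.inl j =>
    induction j using Fin.induction with
    | zero => exact h
    | succ j ih =>
      have h1 : cmp f (Sum.inl j.succ) = cmp f (Sum.inl j.castSucc) ≫ Y.f (Sum.inl j) := 
        (Category.id_comp _).symm.trans (cmp_comm f (Sum.inl j))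
      have h2 : cmp g (Sum.inl j.succ) = cmp g (Sum.inl j.castSucc) ≫ Y.f (Sum.inl j) := 
        (Category.id_comp _).symm.trans (cmp_comm g (Sum.inl j))
      rw [h1, h2, ih]

open Classical in
lemma fold_pre (V : (NakQ QD u m QT w).V → ModuleCat.{0} k)
    (f : ∀ a, V ((NakQ QD u m QT w).s a) ⟶ V ((NakQ QD u m QT w).t a))
    (φ : ∀ j : Fin (m+1), V (nU QD u m QT w) ⟶ V (nC QD u m QT w j))
    (h0 : φ 0 = f (aX QD u m QT w))
    (hs : ∀ j : Fin m, φ j.succ = φ j.castSucc ≫ f (aC QD u m QT w j))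
    (x : ∀ v, V v) (j : Fin (m+1)) :
    (preP QD u m QT w j).foldl (fun x a => opA V f a x) x = Pi.single (nC QD u m QT w j) ((φ j).hom (x (nU QD u m QT w))) := by
  induction j using Fin.induction with
  | zero =>
    rw [h0]
    show opA V f (aX QD u m QT w) x = _
    rw [opA_apply]
    rfl
  | succ j ih =>
    unfold preP at ih ⊢
    rw [Fin.induction_succ, List.foldl_append, ih, hs]
    show opA V f _ _ = _
    rw [opA_apply]
    have : (Pi.single (nC QD u m QT w j.castSucc) ((φ j.castSucc).hom (x (nU QD u m QT w))) : ∀ v, V v)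
       (nC QD u m QT w j.castSucc) = (φ j.castSucc).hom (x (nU QD u m QT w)) := Pi.single_eq_same _ _
    exact congrArg (fun y => (Pi.single (nC QD u m QT w j.succ) ((f (aC QD u m QT w j)).hom y) : ∀ v, V v)) this

open Classical in
lemma fold_rel (V : (NakQ QD u m QT w).V → ModuleCat.{0} k)
    (f : ∀ a, V ((NakQ QD u m QT w).s a) ⟶ V ((NakQ QD u m QT w).t a))
    (φ : ∀ j : Fin (m+1), V (nU QD u m QT w) ⟶ V (nC QD u m QT w j))
    (h0 : φ 0 = f (aX QD u m QT w))
    (hs : ∀ j : Fin m, φ j.succ = φ j.castSucc ≫ f (aC QD u m QT w j))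
    (x : ∀ v, V v) :
    (relP QD u m QT w).foldl (fun x a => opA V f a x) x = Pi.single (nW QD u m QT w)
      ((φ (Fin.last m) ≫ f (aW QD u m QT w)).hom (x (nU QD u m QT w))) := by
  unfold relP
  rw [List.foldl_append, fold_pre V f φ h0 hs]
  show opA V f _ _ = _
  rw [opA_apply]
  have : (Pi.single (nC QD u m QT w (Fin.last m)) ((φ (Fin.last m)).hom (x (nU QD u m QT w))) : ∀ v, V v)
       (nC QD u m QT w (Fin.last m)) = (φ (Fin.last m)).hom (x (nU QD u m QT w)) := Pi.single_eq_same _ _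
  exact congrArg (fun y => (Pi.single (nW QD u m QT w) ((f (aW QD u m QT w)).hom y) : ∀ v, V v)) this

lemma rel_iff (V : (NakQ QD u m QT w).V → ModuleCat.{0} k)
    (f : ∀ a, V ((NakQ QD u m QT w).s a) ⟶ V ((NakQ QD u m QT w).t a))
    (φ : ∀ j : Fin (m+1), V (nU QD u m QT w) ⟶ V (nC QD u m QT w j))
    (h0 : φ 0 = f (aX QD u m QT w))
    (hs : ∀ j : Fin m, φ j.succ = φ j.castSucc ≫ f (aC QD u m QT w j)) :
    (∀ x, (relP QD u m QT w).foldl (fun x a => opA V f a x) x = 0) ↔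
      φ (Fin.last m) ≫ f (aW QD u m QT w) = 0 := by
  classical
  constructor
  · intro h
    apply ModuleCat.hom_ext; apply LinearMap.ext; intro y
    have := h (Pi.single (nU QD u m QT w) y)
    rw [fold_rel V f φ h0 hs] at this
    have h2 := congrFun this (nW QD u m QT w)
    rw [Pi.single_eq_same] at h2
    exact (Pi.single_eq_same (M := fun v => V v) (nW QD u m QT w) _).symm.trans h2
  · intro h x
    rw [fold_rel V f φ h0 hs]
    refine Eq.trans ?_ (Pi.single_zero (nW QD u m QT w))
    exact congrArg (fun t => (Pi.single (nW QD u m QT w) (t.hom (x (nU QD u m QT w))) : ∀ v, V v)) h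

noncomputable def nakF : Comma (HC k QD u m QT w) (𝟭 (QRep k (QC m QT w) ∅)) ⥤ QRep k (NakQ QD u m QT w) {relP QD u m QT w} where
  obj c := 
    { V := fun v => match v with
        | Sum.inl v => c.left.V v
        | Sum.inr v => c.right.V v
      f := fun a => match a with
        | Sum.inl a => c.left.f a
        | Sum.inr (Sum.inl a) => c.right.f a
        | Sum.inr (Sum.inr _) => cmp c.hom (Sum.inl 0)
      rel := fun p hp => by
        have hp : p = _ := hp
        subst hp
        refine (rel_iff (QD := QD) (u := u) (m := m) (QT := QT) (w := w) _ _ (fun j => cmp c.hom (Sum.inl j)) rfl ?_).2 ?_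
        · intro j
          exact (Category.id_comp _).symm.trans (cmp_comm c.hom (Sum.inl j))
        · exact (cmp_comm c.hom (Sum.inr (Sum.inl ()))).symm.trans zero_comp }
  map {c d} g := mkHom (fun v => match v with
        | Sum.inl v => cmp g.left v
        | Sum.inr v => cmp g.right v) (fun a => match a with
        | Sum.inl a => cmp_comm g.left a
        | Sum.inr (Sum.inl a) => cmp_comm g.right a
        | Sum.inr (Sum.inr _) => (congrArg (fun t => cmp t (Sum.inl 0)) g.w).symm)
  map_id c := hom_ext' fun v => match v with
        | Sum.inl v => rfl
        | Sum.inr _ => rfl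
  map_comp f g := hom_ext' fun v => match v with
        | Sum.inl v => rfl
        | Sum.inr _ => rfl

instance : (nakF (k := k) (QD := QD) (u := u) (m := m) (QT := QT) (w := w)).Faithful where
  map_injective {X Y f g} h := by
    apply Comma.hom_ext
    · exact hom_ext' fun v => congrArg (fun t => cmp t (Sum.inl v)) h
    · exact hom_ext' fun v => congrArg (fun t => cmp t (Sum.inr v)) h

instance : (nakF (k := k) (QD := QD) (u := u) (m := m) (QT := QT) (w := w)).Full where
  map_surjective {X Y} f := by
    refine ⟨{ right := mkHom (fun v => cmp f (Sum.inr v)) (fun a => cmp_comm f (Sum.inr (Sum.inl a))), left := mkHom (fun v => cmp f (Sum.inl v)) (fun a => cmp_comm f (Sum.inl a)), w := ?_ }, ?_⟩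
    · apply hc_ext_nak
      exact (cmp_comm f (Sum.inr (Sum.inr ()))).symm
    · exact hom_ext' fun v => match v with
        | Sum.inl v => rfl
        | Sum.inr _ => rfl

/-- composites from the beginning of the chain -/
noncomputable def phiCh (Y : QRep k (QC m QT w) ∅) (W : ModuleCat.{0} k) (g : W ⟶ Y.V (Sum.inl 0)) (j : Fin (m+1)) :
    W ⟶ Y.V (Sum.inl j) :=
  Fin.induction (motive := fun j => W ⟶ Y.V (Sum.inl j)) g (fun j h => h ≫ Y.f (Sum.inl j)) j

lemma phiCh_zero (Y : QRep k (QC m QT w) ∅) (W : ModuleCat.{0} k) (g : W ⟶ Y.V (Sum.inl 0)) :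
   phiCh Y W g 0 = g := by exact Fin.induction_zero (motive := fun j => W ⟶ Y.V (Sum.inl j)) g (fun j h => h ≫ Y.f (Sum.inl j))
lemma phiCh_succ (Y : QRep k (QC m QT w) ∅) (W : ModuleCat.{0} k) (g : W ⟶ Y.V (Sum.inl 0)) (j : Fin m) :
   phiCh Y W g j.succ = phiCh Y W g j.castSucc ≫ Y.f (Sum.inl j) := by exact Fin.induction_succ (motive := fun j => W ⟶ Y.V (Sum.inl j)) g (fun j h => h ≫ Y.f (Sum.inl j)) j

instance : (nakF (k := k) (QD := QD) (u := u) (m := m) (QT := QT) (w := w)).EssSurj where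
  mem_essImage Y := by
    let Y1 : QRep k (QC m QT w) ∅ := ⟨fun v => Y.V (Sum.inr v), fun a => Y.f (Sum.inr (Sum.inl a)), fun p hp => hp.elim⟩
    let X1 : QRep k QD ∅ := ⟨fun v => Y.V (Sum.inl v), fun a => Y.f (Sum.inl a), fun p hp => hp.elim⟩
    let g : X1.V u ⟶ Y1.V (Sum.inl 0) := Y.f (Sum.inr (Sum.inr ()))
    have hr := (rel_iff (QD := QD) (u := u) (m := m) (QT := QT) (w := w) Y.V Y.f (fun j => phiCh Y1 _ g j) (phiCh_zero Y1 _ g) (phiCh_succ Y1 _ g)).1 (Y.rel _ rfl)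
    let h : (HC k QD u m QT w).obj X1 ⟶ Y1 := mkHom (fun v => match v with
        | Sum.inl j => phiCh Y1 _ g j
        | Sum.inr _ => 0) (fun a => match a with
        | Sum.inl j => (Category.id_comp _).trans (phiCh_succ Y1 _ g j)
        | Sum.inr (Sum.inl _) => zero_comp.trans hr.symm
        | Sum.inr (Sum.inr _) => Z0_from k _ _)
    refine ⟨{ left := X1, right := Y1, hom := h}, ⟨mkIso (fun v => match v with
        | Sum.inl v => Iso.refl _
        | Sum.inr _ => Iso.refl _) (fun a => match a with
        | Sum.inl a => rfl
        | Sum.inr (Sum.inl _) => rfl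
        | Sum.inr (Sum.inr _) => ?_)⟩⟩
    exact (Category.comp_id _).trans ((phiCh_zero Y1 _ g).trans (Category.id_comp _).symm)

lemma nak_star (k : Type) [Field k] (QD : PreQuiver) (u : QD.V) (m : ℕ) (QT : PreQuiver) (w : QT.V) :
    TE (QRep k (NakQ QD u m QT w) {relP QD u m QT w}) (QRep k (StarQ QD u m QT w) ∅) :=
  ((te_of_functor nakF).symm.trans (lemmaR (HC k QD u m QT w)).symm).trans (te_of_functor starF)

end
end NakE7

-- Part 14

namespace NakE7
open Limits MulOpposite

section

/-- reverse all arrows starting at `v` -/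
def reflQ (Q : PreQuiver) [DecidableEq Q.V] (v : Q.V) : PreQuiver where
  V := Q.V
  A := Q.A
  s a := if Q.s a = v then Q.t a else Q.s a
  t a := if Q.s a = v then v else Q.t a

/-- delete a source -/
def delQ (Q : PreQuiver) [DecidableEq Q.V] (v : Q.V) (hv : ∀ a, Q.t a ≠ v) : PreQuiver where
  V := {x : Q.V // x ≠ v}
  A := {a : Q.A // Q.s a ≠ v}
  s a := ⟨Q.s a.1, a.2⟩
  t a := ⟨Q.t a.1, hv _⟩

def delV (V : Type) [DecidableEq V] (v : V) : {x : V // x ≠ v} ⊕ Unit ≃ V where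
  toFun := Sum.elim (fun x => x.1) (fun _ => v)
  invFun x := if h : x = v then Sum.inr () else Sum.inl ⟨x, h⟩
  left_inv x := by
    rcases x with ⟨x, hx⟩ | x
    · simp [hx]
    · simp
  right_inv x := by by_cases h : x = v <;> simp [h]

lemma reflect (k : Type) [Field k] (Q : PreQuiver) [DecidableEq Q.V] [Fintype Q.A] (v : Q.V) (hv : ∀ a, Q.t a ≠ v) :
    TE (QRep k Q ∅) (QRep k (reflQ Q v) ∅) := by
  let I := {a : Q.A // ¬ (Q.s a ≠ v)}
  let τ : I → (delQ Q v hv).V := fun a => ⟨Q.t a.1, hv _⟩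
  let e1 : QI (OutQ (delQ Q v hv) I τ) ∅ Q ∅ :=
    { eV := delV Q.V v
      eA := Equiv.sumCompl (fun a => Q.s a ≠ v)
      hs := fun a => by
        rcases a with a | ⟨a, ha⟩
        · rfl
        · exact not_not.1 ha
      ht := fun a => by
        rcases a with a | a
        · rfl
        · rfl
      hR := fun p => by simp }
  let e2 : QI (InQ (delQ Q v hv) I τ) ∅ (reflQ Q v) ∅ :=
    { eV := delV Q.V v
      eA := Equiv.sumCompl (fun a => Q.s a ≠ v)
      hs := fun a => by
        rcases a with ⟨a, ha⟩ | ⟨a, ha⟩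
        · exact if_neg ha
        · exact if_pos (not_not.1 ha)
      ht := fun a => by
        rcases a with ⟨a, ha⟩ | ⟨a, ha⟩
        · exact if_neg ha
        · exact if_pos (not_not.1 ha)
      hR := fun p => by simp }
  exact ((e1.te k).symm.trans (reflection k _ I τ)).trans (e2.te k)

def ea : Fin 6 → Fin 7 := ![0, 1, 2, 3, 4, 2]
def eb : Fin 6 → Fin 7 := ![1, 2, 3, 4, 5, 6]

/-- an orientation of E7 -/
def EQ (ε : Fin 6 → Bool) : PreQuiver where
  V := Fin 7
  A := Fin 6
  s e := if ε e then ea e else eb e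
  t e := if ε e then eb e else ea e

def flipE (ε : Fin 6 → Bool) (v : Fin 7) : Fin 6 → Bool := fun e => if ea e = v ∨ eb e = v then !ε e else ε e

def isSrc (ε : Fin 6 → Bool) (v : Fin 7) : Prop := ∀ e, (if ε e then eb e else ea e) ≠ v
instance (ε v) : Decidable (isSrc ε v) := by unfold isSrc; infer_instance

lemma eab (e : Fin 6) : ea e ≠ eb e := by revert e; decide

lemma te_flip (k : Type) [Field k] (ε : Fin 6 → Bool) (v : Fin 7) (h : isSrc ε v) :
    TE (QRep k (EQ ε) ∅) (QRep k (EQ (flipE ε v)) ∅) := by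
  letI : DecidableEq (EQ ε).V := inferInstanceAs (DecidableEq (Fin 7))
  letI : Fintype (EQ ε).A := inferInstanceAs (Fintype (Fin 6))
  refine (reflect k (EQ ε) v h).trans (QI.te k ?_)
  exact
   { eV := Equiv.refl (Fin 7)
     eA := Equiv.refl (Fin 6)
     hs := fun e => by
       show (if flipE ε v e then ea e else eb e) = if (if ε e then ea e else eb e) = v then (if ε e then eb e else ea e) else (if ε e then ea e else eb e)
       have h1 : (if ε e then eb e else ea e) ≠ v := h e
       have h2 := eab e
       unfold flipE
       generalize ε e = b at *
       cases b <;> by_cases h3 : ea e = v <;> by_cases h4 : eb e = v <;> simp_all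
     ht := fun e => by
       show (if flipE ε v e then eb e else ea e) = if (if ε e then ea e else eb e) = v then v else (if ε e then eb e else ea e)
       have h1 : (if ε e then eb e else ea e) ≠ v := h e
       have h2 := eab e
       unfold flipE
       generalize ε e = b at *
       cases b <;> by_cases h3 : ea e = v <;> by_cases h4 : eb e = v <;> simp_all
     hR := fun p => by simp }

lemma flip_flip (ε v) : flipE (flipE ε v) v = ε := by
  funext e
  unfold flipE
  by_cases h : ea e = v ∨ eb e = v <;> simp [h]

def tbl : List (Fin 7) := [5, 5, 5, 5, 6, 6, 6, 6, 5, 5, 5, 5, 6, 6, 6, 6, 4, 4, 4, 4, 6, 6, 6, 6, 0, 1, 2, 2, 6, 6, 6, 6, 5, 5, 5, 5, 5, 5, 5, 5, 5, 5, 5, 5, 5, 5, 5, 5, 4, 4, 4, 4, 4, 4, 4, 4, 3, 3, 3, 3, 0, 1, 0, 0]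

def code (ε : Fin 6 → Bool) : ℕ := ∑ e, if ε e then 2 ^ e.1 else 0
def stepE (ε : Fin 6 → Bool) : Fin 6 → Bool := flipE ε (tbl.getD (code ε) 0)
def std : Fin 6 → Bool := fun _ => true
def okE (ε : Fin 6 → Bool) : Prop := ε = std ∨ isSrc ε (tbl.getD (code ε) 0) ∨ isSrc (stepE ε) (tbl.getD (code ε) 0)
instance (ε) : Decidable (okE ε) := by unfold okE; infer_instance
def goE : ℕ → (Fin 6 → Bool) → (Fin 6 → Bool)
  | 0, ε => ε
  | n+1, ε => if ε = std then ε else goE n (stepE ε)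

lemma ok_all : ∀ ε, okE ε := by decide +kernel
lemma go_all : ∀ ε, goE 30 ε = std := by decide +kernel

lemma te_go (k : Type) [Field k] (n : ℕ) : ∀ ε, TE (QRep k (EQ ε) ∅) (QRep k (EQ (goE n ε)) ∅) := by
  induction n with
  | zero => intro ε; exact TE.refl _
  | succ n ih =>
    intro ε
    by_cases h : ε = std
    · have : goE (n+1) ε = ε := by unfold goE; rw [if_pos h]
      rw [this]; exact TE.refl _
    · have : goE (n+1) ε = goE n (stepE ε) := by rw [goE, if_neg h]
      rw [this]
      refine TE.trans ?_ (ih _)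
      rcases ok_all ε with h1 | h1 | h1
      · exact absurd h1 h
      · exact te_flip k ε _ h1
      · have := te_flip k _ _ h1
        unfold stepE at this
        rw [flip_flip] at this
        exact this.symm

lemma te_EQ (k : Type) [Field k] (ε ε') : TE (QRep k (EQ ε) ∅) (QRep k (EQ ε') ∅) := by
  have h1 := te_go k 30 ε
  have h2 := te_go k 30 ε'
  rw [go_all] at h1 h2
  exact h1.trans h2.symm

lemma te_shape (k : Type) [Field k] (Q : PreQuiver) (eV : Q.V → Fin 7) (eA : Q.A → Fin 6)
    (hV : Function.Bijective eV) (hA : Function.Bijective eA)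
    (h : ∀ a, (eV (Q.s a) = ea (eA a) ∧ eV (Q.t a) = eb (eA a)) ∨ (eV (Q.s a) = eb (eA a) ∧ eV (Q.t a) = ea (eA a))) :
    TE (QRep k Q ∅) (QRep k (EQ std) ∅) := by
  let A := Equiv.ofBijective eA hA
  let ε : Fin 6 → Bool := fun e => decide (eV (Q.s (A.symm e)) = ea e)
  have hε : ∀ a, ε (eA a) = decide (eV (Q.s a) = ea (eA a)) := fun a => by
    have : A.symm (eA a) = a := A.symm_apply_apply a
    simp only [ε, this]
  refine TE.trans (QI.te k (R' := ∅) ?_) (te_EQ k ε std)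
  exact
   { eV := Equiv.ofBijective eV hV
     eA := A
     hs := fun a => by
       show (if ε (eA a) then ea (eA a) else eb (eA a)) = eV (Q.s a)
       have h2 := eab (eA a)
       rw [hε]
       rcases h a with h1 | h1
       · simp [h1.1]
       · simp [h1.1, h2.symm]
     ht := fun a => by
       show (if ε (eA a) then eb (eA a) else ea (eA a)) = eV (Q.t a)
       have h2 := eab (eA a)
       rw [hε]
       rcases h a with h1 | h1
       · simp [h1.1, h1.2]
       · simp [h1.1, h1.2, h2.symm]
     hR := fun p => by simp }

def eIdx (x y : Fin 7) : Fin 6 := if x = 6 ∨ y = 6 then 5 else Fin.ofNat 6 (min x.1 y.1)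

lemma adj_iff (x y : Fin 7) : dynkinE7.Adj x y ↔ (x = ea (eIdx x y) ∧ y = eb (eIdx x y)) ∨ (x = eb (eIdx x y) ∧ y = ea (eIdx x y)) := by
  unfold dynkinE7
  rw [SimpleGraph.fromRel_adj]
  revert x y
  decide +kernel

lemma te_orient (k : Type) [Field k] (o : Fin 7 → Fin 7 → Prop) (ho : IsOrientation dynkinE7 o) :
    TE (QRep k (orientQuiver (Fin 7) o) ∅) (QRep k (EQ std) ∅) := by
  have ha : ∀ x y, o x y → (x = ea (eIdx x y) ∧ y = eb (eIdx x y)) ∨ (x = eb (eIdx x y) ∧ y = ea (eIdx x y)) :=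
    fun x y h => (adj_iff x y).1 ((ho.1 x y).2 (Or.inl h))
  refine te_shape k _ (fun v => v) (fun a => eIdx a.1.1 a.1.2) Function.bijective_id ⟨?_, ?_⟩ ?_
  · rintro ⟨⟨x, y⟩, h⟩ ⟨⟨x', y'⟩, h'⟩ hh
    have hh : eIdx x y = eIdx x' y' := hh
    have h : o x y := h
    have h' : o x' y' := h'
    apply Subtype.ext
    show (x, y) = (x', y')
    have h1 := ha x y h
    have h2 := ha x' y' h'
    rw [hh] at h1
    rcases h1 with ⟨p, q⟩ | ⟨p, q⟩ <;> rcases h2 with ⟨p', q'⟩ | ⟨p', q'⟩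
    · exact Prod.ext (p.trans p'.symm) (q.trans q'.symm)
    · exfalso; apply ho.2 _ _ h; rw [p, q, ← p', ← q']; exact h'
    · exfalso; apply ho.2 _ _ h; rw [p, q, ← p', ← q']; exact h'
    · exact Prod.ext (p.trans p'.symm) (q.trans q'.symm)
  · intro e
    have hadj : dynkinE7.Adj (ea e) (eb e) ∧ eIdx (ea e) (eb e) = e ∧ eIdx (eb e) (ea e) = e := by
      rw [adj_iff]; revert e; decide +kernel
    rcases (ho.1 _ _).1 hadj.1 with h | h
    · exact ⟨⟨(ea e, eb e), h⟩, hadj.2.1⟩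
    · exact ⟨⟨(eb e, ea e), h⟩, hadj.2.2⟩
  · rintro ⟨⟨x, y⟩, h⟩
    exact ha x y h

end
end NakE7

-- Part 15

namespace NakE7
open Limits MulOpposite

section

/-- the glued quiver with `a+1`, `m+1`, `r+1` vertices in the three parts -/
abbrev NQ (a m r : ℕ) : PreQuiver := NakQ (linQuiver (a+1)) (Fin.last a : Fin (a+1)) m (linQuiver (r+1)) (0 : Fin (r+1))
abbrev SQ (a m r : ℕ) : PreQuiver := StarQ (linQuiver (a+1)) (Fin.last a : Fin (a+1)) m (linQuiver (r+1)) (0 : Fin (r+1))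
abbrev NR (a m r : ℕ) : List (NQ a m r).A := relP (linQuiver (a+1)) (Fin.last a : Fin (a+1)) m (linQuiver (r+1)) (0 : Fin (r+1))

abbrev VT (a m r : ℕ) := Fin (a+1) ⊕ (Fin (m+1) ⊕ Fin (r+1))
abbrev AT (a m r : ℕ) := Fin a ⊕ ((Fin m ⊕ (Unit ⊕ Fin r)) ⊕ Unit)

def nV (a m r : ℕ) : VT a m r → Fin 7 :=
  Sum.elim (fun i => Fin.ofNat 7 i.1) (Sum.elim (fun j => Fin.ofNat 7 (a+1+j.1)) (fun t => Fin.ofNat 7 (a+m+2+t.1)))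
def nA (a m r : ℕ) : AT a m r → Fin 6 :=
  Sum.elim (fun i => Fin.ofNat 6 i.1) (Sum.elim (Sum.elim (fun j => Fin.ofNat 6 (a+1+j.1))
    (Sum.elim (fun _ => Fin.ofNat 6 (a+1+m)) (fun t => Fin.ofNat 6 (a+m+2+t.1)))) (fun _ => Fin.ofNat 6 a))

lemma te_nak (k : Type) [Field k] (a m r : ℕ) (hV : Function.Bijective (nV a m r)) (hA : Function.Bijective (nA a m r))
    (hs : ∀ x : AT a m r, (linQuiver 7).s (nA a m r x) = nV a m r ((NQ a m r).s x))
    (ht : ∀ x : AT a m r, (linQuiver 7).t (nA a m r x) = nV a m r ((NQ a m r).t x))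
    (hR : (NR a m r).map (nA a m r) = linPath 7 (a+1) (m+2)) :
    TE (QRep k (linQuiver 7) {p | ∃ i : Fin 1, p = linPath 7 (a+1) (m+2)}) (QRep k (SQ a m r) ∅) := by
  refine TE.trans (TE.symm (QI.te k ?_)) (nak_star k _ _ m _ _)
  exact
   { eV := Equiv.ofBijective _ hV
     eA := Equiv.ofBijective _ hA
     hs := hs
     ht := ht
     hR := fun p => by
       show p = NR a m r ↔ ∃ i : Fin 1, p.map (nA a m r) = linPath 7 (a+1) (m+2)
       constructor
       · rintro rfl; exact ⟨0, hR⟩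
       · rintro ⟨_, h⟩
         exact List.map_injective_iff.2 hA.1 (h.trans hR.symm) }

/-- position on the arm of given length -/
def pos (L d : ℕ) : Fin 7 := if d = 0 then 2 else if L = 1 then 6 else if L = 2 then Fin.ofNat 7 (2 - d) else Fin.ofNat 7 (2 + d)

def sV (a m r : ℕ) : VT a m r → Fin 7 :=
  Sum.elim (fun i => pos (a+1) (a+1-i.1)) (Sum.elim (fun j => pos m (m - j.1)) (fun t => pos (r+1) (t.1+1)))
def sA (a m r : ℕ) : AT a m r → Fin 6 := fun x => eIdx (sV a m r ((SQ a m r).s x)) (sV a m r ((SQ a m r).t x))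

lemma te_star (k : Type) [Field k] (a m r : ℕ) (hV : Function.Bijective (sV a m r)) (hA : Function.Bijective (sA a m r))
    (h : ∀ x : AT a m r, (sV a m r ((SQ a m r).s x) = ea (sA a m r x) ∧ sV a m r ((SQ a m r).t x) = eb (sA a m r x)) ∨
      (sV a m r ((SQ a m r).s x) = eb (sA a m r x) ∧ sV a m r ((SQ a m r).t x) = ea (sA a m r x))) :
    TE (QRep k (SQ a m r) ∅) (QRep k (EQ std) ∅) :=
  te_shape k _ (sV a m r) (sA a m r) hV hA h

def linS : Fin 6 → Fin 7 := (linQuiver 7).s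
def linT : Fin 6 → Fin 7 := (linQuiver 7).t
def mapR (a m r : ℕ) : List (Fin 6) := (NR a m r).map (nA a m r)
def linP (a m : ℕ) : List (Fin 6) := linPath 7 (a+1) (m+2)

def good (a m r : ℕ) : Prop := Function.Bijective (nV a m r) ∧ Function.Bijective (nA a m r) ∧
  (∀ x : AT a m r, linS (nA a m r x) = nV a m r ((NQ a m r).s x)) ∧
  (∀ x : AT a m r, linT (nA a m r x) = nV a m r ((NQ a m r).t x)) ∧
  mapR a m r = linP a m ∧
  Function.Bijective (sV a m r) ∧ Function.Bijective (sA a m r) ∧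
  (∀ x : AT a m r, (sV a m r ((SQ a m r).s x) = ea (sA a m r x) ∧ sV a m r ((SQ a m r).t x) = eb (sA a m r x)) ∨
      (sV a m r ((SQ a m r).s x) = eb (sA a m r x) ∧ sV a m r ((SQ a m r).t x) = ea (sA a m r x)))

instance (a m r : ℕ) : Decidable (good a m r) := by unfold good; infer_instance

lemma te_good (k : Type) [Field k] (a m r : ℕ) (h : good a m r) :
    TE (QRep k (linQuiver 7) {p | ∃ i : Fin 1, p = linPath 7 (a+1) (m+2)}) (QRep k (EQ std) ∅) := by
  obtain ⟨h1, h2, h3, h4, h5, h6, h7, h8⟩ := h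
  exact (te_nak k a m r h1 h2 h3 h4 h5).trans (te_star k a m r h6 h7 h8)

lemma good1 : good 0 2 2 := by decide +kernel
lemma good2 : good 0 3 1 := by decide +kernel
lemma good3 : good 1 1 2 := by decide +kernel
lemma good4 : good 1 3 0 := by decide +kernel
lemma good5 : good 2 1 1 := by decide +kernel
lemma good6 : good 2 2 0 := by decide +kernel

lemma te_data (k : Type) [Field k] (p : ℕ × ℕ) (hp : p ∈ e7Data) :
    TE (QRep k (linQuiver 7) {q | ∃ i : Fin 1, q = linPath 7 ((fun _ => p.1 : Fin 1 → ℕ) i) ((fun _ => p.2 : Fin 1 → ℕ) i)}) (QRep k (EQ std) ∅) := by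
  unfold e7Data at hp
  simp only [List.mem_cons, List.not_mem_nil, or_false] at hp
  rcases hp with rfl | rfl | rfl | rfl | rfl | rfl
  · exact te_good k 0 2 2 good1
  · exact te_good k 0 3 1 good2
  · exact te_good k 1 1 2 good3
  · exact te_good k 1 3 0 good4
  · exact te_good k 2 1 1 good5
  · exact te_good k 2 2 0 good6

lemma main_thm (k : Type) [Field k] :
    (∀ p ∈ e7Data, ∀ q ∈ e7Data,
      DerivedEquivalent k (NakayamaAlgebra k 7 1 (fun _ => p.1) (fun _ => p.2))
        (NakayamaAlgebra k 7 1 (fun _ => q.1) (fun _ => q.2))) ∧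
    (∀ p ∈ e7Data, ∀ o : Fin 7 → Fin 7 → Prop, IsOrientation dynkinE7 o →
      DerivedEquivalent k (NakayamaAlgebra k 7 1 (fun _ => p.1) (fun _ => p.2))
        (PathAlgebra k (orientQuiver (Fin 7) o))) :=
  ⟨fun p hp q hq => de_of_te ((te_data k p hp).trans (te_data k q hq).symm),
   fun p hp o ho => de_of_te ((te_data k p hp).trans (te_orient k o ho).symm)⟩

end
end NakE7

/-- The six linear Nakayama algebras `A_{7,(1)}^{(4)}`, `A_{7,(1)}^{(5)}`,
`A_{7,(2)}^{(3)}`, `A_{7,(2)}^{(5)}`, `A_{7,(3)}^{(3)}` and `A_{7,(3)}^{(4)}` are pairwise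
derived equivalent, and each of them is derived equivalent to the path algebra of any
orientation of the Dynkin tree `E_7`. -/
theorem nakayama_E7 (k : Type) [Field k] :
    (∀ p ∈ e7Data, ∀ q ∈ e7Data,
      DerivedEquivalent k (NakayamaAlgebra k 7 1 (fun _ => p.1) (fun _ => p.2))
        (NakayamaAlgebra k 7 1 (fun _ => q.1) (fun _ => q.2))) ∧
    (∀ p ∈ e7Data, ∀ o : Fin 7 → Fin 7 → Prop, IsOrientation dynkinE7 o →
      DerivedEquivalent k (NakayamaAlgebra k 7 1 (fun _ => p.1) (fun _ => p.2))
        (PathAlgebra k (orientQuiver (Fin 7) o))) := by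
  exact NakE7.main_thm k
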